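/- arXiv:2307.02282 — 2 statements merged into one kernel-verified Lean document; each statement's English description precedes it below -/
import Mathlib

section
/- (Laurent phenomenon for principal coefficients.) Let B be an n×n skew-symmetrizable integer matrix. Then every cluster variable z of the cluster algebra with principal coefficients A(B) lies in the subring ℤ[x_1^{±1},…,x_n^{±1},y_1,…,y_n] of F, i.e., the subring of F generated over ℤ by x_1,…,x_n, their inverses, and y_1,…,y_n. Equivalently, z = f(x_1,…,x_n,y_1,…,y_n)/(x_1^{d_1}⋯x_n^{d_n}) for some polynomial f with integer coefficients and some d_1,…,d_n ∈ ℤ_{≥0}. -/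
noncomputable section

/-- The ambient field `F`: the field of rational functions in `2n` variables over `ℚ`,
realized as the fraction field of the polynomial ring in the `2n` indeterminates
`x_1, …, x_n` (indexed by `Sum.inl`) and `y_1, …, y_n` (indexed by `Sum.inr`). -/
abbrev CField (n : ℕ) : Type := FractionRing (MvPolynomial (Fin n ⊕ Fin n) ℚ)

/-- The initial cluster variables `x_1, …, x_n` and coefficients `y_1, …, y_n`:
the images in `F` of the `2n` standard indeterminates. -/
def initX (n : ℕ) : Fin n ⊕ Fin n → CField n :=
  fun i => algebraMap (MvPolynomial (Fin n ⊕ Fin n) ℚ) (CField n) (MvPolynomial.X i)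

/-- Mutation of an integer matrix (rows indexed by `ρ`, columns by `Fin n`) at column `k`,
where `e : Fin n → ρ` identifies each column index with a row index. -/
def matMutate {ρ : Type*} [DecidableEq ρ] {n : ℕ} (e : Fin n → ρ)
    (A : Matrix ρ (Fin n) ℤ) (k : Fin n) : Matrix ρ (Fin n) ℤ :=
  fun i j =>
    if i = e k ∨ j = k then -A i j
    else A i j + A i k * max (A (e k) j) 0 + max (-A i k) 0 * A (e k) j

/-- The mutated `2n`-tuple of the seed mutation at `k`. -/
def seedMutX {n : ℕ} (x : Fin n ⊕ Fin n → CField n)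
    (A : Matrix (Fin n ⊕ Fin n) (Fin n) ℤ) (k : Fin n) : Fin n ⊕ Fin n → CField n
  | Sum.inl i =>
      if i = k then
        (x (Sum.inl k))⁻¹ *
          ((∏ i' : Fin n, x (Sum.inl i') ^ (A (Sum.inl i') k).toNat) *
              (∏ i' : Fin n, x (Sum.inr i') ^ (A (Sum.inr i') k).toNat) +
            (∏ i' : Fin n, x (Sum.inl i') ^ (-(A (Sum.inl i') k)).toNat) *
              (∏ i' : Fin n, x (Sum.inr i') ^ (-(A (Sum.inr i') k)).toNat))
      else x (Sum.inl i)
  | Sum.inr i => x (Sum.inr i)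

/-- Mutation of a pair (`2n`-tuple, `2n × n` matrix) at `k`. -/
def mutatePair {n : ℕ}
    (p : (Fin n ⊕ Fin n → CField n) × Matrix (Fin n ⊕ Fin n) (Fin n) ℤ)
    (k : Fin n) : (Fin n ⊕ Fin n → CField n) × Matrix (Fin n ⊕ Fin n) (Fin n) ℤ :=
  (seedMutX p.1 p.2 k, matMutate Sum.inl p.2 k)

/-- The principal extension `B̂` of an `n × n` matrix `B`: the `2n × n` matrix whose upper
part is `B` and whose lower part is the identity matrix. -/
def principalExt {n : ℕ} (B : Matrix (Fin n) (Fin n) ℤ) :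
    Matrix (Fin n ⊕ Fin n) (Fin n) ℤ
  | Sum.inl i, j => B i j
  | Sum.inr i, j => if i = j then 1 else 0

/-- `z` is a cluster variable of the cluster algebra with principal coefficients `A(B)`:
it is one of the first `n` components of a seed obtained from the initial seed `(x, B̂)`
by a finite sequence of mutations. -/
def IsClusterVariable {n : ℕ} (B : Matrix (Fin n) (Fin n) ℤ) (z : CField n) : Prop :=
  ∃ (L : List (Fin n)) (i : Fin n),
    z = (L.foldl mutatePair (initX n, principalExt B)).1 (Sum.inl i)

theorem graded_nz {A : Type*} [CommRing A] (𝒜 : ℤ → AddSubgroup A) [GradedRing 𝒜]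
    {P N D : A} {e r δ : ℤ} (hP : P ∈ 𝒜 r) (hN : N ∈ 𝒜 e) (hD : D ∈ 𝒜 (e + δ)) (hδ : 0 < δ)
    (hNZ : ∀ G, P ∣ G * N → P ∣ G) (G : A) (h : P ∣ G * (N + D)) : P ∣ G := by
  classical
  have hcomp : ∀ (H : A) (s : ℤ), P ∣ H → P ∣ (DirectSum.decompose 𝒜 H s : A) := by
    rintro _ s ⟨K, rfl⟩
    have := DirectSum.coe_decompose_mul_add_of_left_mem 𝒜 (j := s - r) (b := K) hP
    rw [show r + (s - r) = s by ring] at this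
    rw [this]; exact dvd_mul_right _ _
  have key : ∀ s : ℤ, P ∣ (DirectSum.decompose 𝒜 G s : A) * N
      + (DirectSum.decompose 𝒜 G (s - δ) : A) * D := by
    intro s
    have h1 := hcomp _ (s + e) h
    rw [mul_add, DirectSum.decompose_add, DirectSum.add_apply, AddMemClass.coe_add,
      DirectSum.coe_decompose_mul_add_of_right_mem 𝒜 hN] at h1
    have h2 := DirectSum.coe_decompose_mul_add_of_right_mem 𝒜 (i := s - δ) (a := G) hD
    rw [show s - δ + (e + δ) = s + e by ring] at h2
    rwa [h2] at h1
  obtain ⟨b, hb⟩ : ∃ b : ℤ, ∀ s, s < b → DirectSum.decompose 𝒜 G s = 0 := by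
    obtain ⟨b, hb⟩ := (DFinsupp.support (DirectSum.decompose 𝒜 G)).bddBelow
    refine ⟨b, fun s hs => ?_⟩
    by_contra hne
    have := hb (a := s) (by simpa using hne)
    omega
  have all : ∀ m : ℕ, ∀ s : ℤ, s < b + m → P ∣ (DirectSum.decompose 𝒜 G s : A) := by
    intro m
    induction m with
    | zero =>
      intro s hs
      rw [hb s (by simpa using hs)]
      simp
    | succ m ih =>
      intro s hs
      apply hNZ
      have h2 := ih (s - δ) (by push_cast at hs; omega)
      exact (dvd_add_left (h2.mul_right D)).1 (key s)
  rw [← DirectSum.sum_support_decompose 𝒜 G]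
  apply Finset.dvd_sum
  intro s _
  exact all (s - b + 1).toNat s (by have := Int.self_le_toNat (s - b + 1); omega)

def mon {n : ℕ} (e : Fin n ⊕ Fin n → ℕ) : MvPolynomial (Fin n ⊕ Fin n) ℤ :=
  ∏ k, MvPolynomial.X k ^ e k

theorem mon_homog {n : ℕ} (w : Fin n ⊕ Fin n → ℤ) (e : Fin n ⊕ Fin n → ℕ) :
    MvPolynomial.IsWeightedHomogeneous w (mon e) (∑ k, (e k : ℤ) * w k) := by
  unfold mon
  have := MvPolynomial.IsWeightedHomogeneous.prod (w := w) (Finset.univ)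
    (fun k => (MvPolynomial.X k : MvPolynomial (Fin n ⊕ Fin n) ℤ) ^ e k) (fun k => e k • w k)
    (fun k _ => (MvPolynomial.isWeightedHomogeneous_X ℤ w k).pow (e k))
  simpa using this

theorem mon_nz_X {n : ℕ} (P : MvPolynomial (Fin n ⊕ Fin n) ℤ) (k : Fin n ⊕ Fin n)
    (hk : ¬ MvPolynomial.X k ∣ P) (G : MvPolynomial (Fin n ⊕ Fin n) ℤ)
    (h : P ∣ G * MvPolynomial.X k) : P ∣ G := by
  obtain ⟨H, hH⟩ := h
  have hp : Prime (MvPolynomial.X k : MvPolynomial (Fin n ⊕ Fin n) ℤ) := MvPolynomial.X_prime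
  have : MvPolynomial.X k ∣ P * H := hH ▸ dvd_mul_left _ _
  rcases hp.dvd_or_dvd this with h1 | ⟨H', rfl⟩
  · exact absurd h1 hk
  · refine ⟨H', mul_right_cancel₀ hp.ne_zero ?_⟩
    rw [hH]; ring

theorem nz_prod {R ι : Type*} [CommRing R] (P : R) (s : Finset ι) (f : ι → R)
    (e : ι → ℕ) (h : ∀ i G, P ∣ G * f i → P ∣ G) : ∀ G, P ∣ G * ∏ i ∈ s, f i ^ e i → P ∣ G := by
  classical
  have hpow : ∀ i m G, P ∣ G * f i ^ m → P ∣ G := by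
    intro i m
    induction m with
    | zero => intro G; simp
    | succ m ih =>
      intro G hG
      rw [pow_succ, ← mul_assoc] at hG
      exact ih _ (h _ _ hG)
  induction s using Finset.induction_on with
  | empty => intro G; simp
  | insert a s ha ih =>
    intro G hG
    rw [Finset.prod_insert ha, ← mul_assoc] at hG
    exact hpow _ _ _ (ih _ hG)

theorem mon_nz {n : ℕ} (P : MvPolynomial (Fin n ⊕ Fin n) ℤ)
    (hP : ∀ k, ¬ MvPolynomial.X k ∣ P) (e : Fin n ⊕ Fin n → ℕ) :
    ∀ G, P ∣ G * mon e → P ∣ G :=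
  nz_prod P _ _ e (fun k G => mon_nz_X P k (hP k) G)

theorem binom_not_dvd {n : ℕ} (e e' : Fin n ⊕ Fin n → ℕ) (h : ∀ k, e k = 0 ∨ e' k = 0)
    (k : Fin n ⊕ Fin n) : ¬ MvPolynomial.X k ∣ mon e + mon e' := by
  rintro ⟨H, hH⟩
  have := congrArg (MvPolynomial.eval (fun l => if l = k then (0 : ℤ) else 1)) hH
  have hm : ∀ e : Fin n ⊕ Fin n → ℕ, MvPolynomial.eval (fun l => if l = k then (0 : ℤ) else 1)
      (mon e) = if e k = 0 then 1 else 0 := by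
    intro e
    unfold mon
    rw [map_prod]
    rw [Finset.prod_eq_single k]
    · simp [zero_pow_eq]
    · intro b _ hb; simp [hb]
    · simp
  rw [map_add, hm, hm, map_mul] at this
  simp at this
  rcases h k with h | h <;> simp [h] at this <;> split_ifs at this <;> omega

theorem exists_weight {ι : Type*} [Fintype ι] (a b : ι → ℤ)
    (hab : ∀ s t : ℤ, (∀ k, s * a k + t * b k = 0) → s = 0 ∧ t = 0) :
    ∃ w : ι → ℤ, ∑ k, a k * w k = 0 ∧ 0 < ∑ k, b k * w k := by
  set α := ∑ k, a k * a k with hα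
  set β := ∑ k, a k * b k with hβ
  have hα0 : 0 < α := by
    have h0 : 0 ≤ α := Finset.sum_nonneg fun k _ => mul_self_nonneg _
    rcases h0.lt_or_eq with h | h
    · exact h
    · exfalso
      have h1 := (Finset.sum_eq_zero_iff_of_nonneg (fun k _ => mul_self_nonneg (a k))).1 h.symm
      have := hab 1 0 (fun k => by simpa using h1 k (Finset.mem_univ k))
      omega
  have e1 : ∑ k, a k * (α * b k - β * a k) = 0 := by
    have : ∑ k, a k * (α * b k - β * a k) = α * β - β * α := by
      rw [hβ, hα, Finset.mul_sum, Finset.mul_sum, ← hα, ← hβ, ← Finset.sum_sub_distrib]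
      exact Finset.sum_congr rfl fun k _ => by ring
    rw [this]; ring
  refine ⟨fun k => α * b k - β * a k, e1, ?_⟩
  have h2 : ∑ k, (α * b k - β * a k) * (α * b k - β * a k)
      = α * ∑ k, b k * (α * b k - β * a k) - β * ∑ k, a k * (α * b k - β * a k) := by
    rw [Finset.mul_sum, Finset.mul_sum, ← Finset.sum_sub_distrib]
    exact Finset.sum_congr rfl fun k _ => by ring
  rw [e1] at h2
  have h3 : 0 < ∑ k, (α * b k - β * a k) * (α * b k - β * a k) := by
    have h0 : 0 ≤ ∑ k, (α * b k - β * a k) * (α * b k - β * a k) :=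
      Finset.sum_nonneg fun k _ => mul_self_nonneg _
    rcases h0.lt_or_eq with h | h
    · exact h
    · exfalso
      have h1 := (Finset.sum_eq_zero_iff_of_nonneg
        (fun k _ => mul_self_nonneg (α * b k - β * a k))).1 h.symm
      have := hab (-β) α (fun k => by
        have := h1 k (Finset.mem_univ k)
        rw [mul_self_eq_zero] at this
        linarith)
      omega
  rw [h2] at h3
  simp only [mul_zero, sub_zero] at h3
  exact (mul_pos_iff_of_pos_left hα0).1 h3

/-- binomials with independent exponent directions: nonzerodivisor -/
theorem binom_nz {n : ℕ} (a b : Fin n ⊕ Fin n → ℤ)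
    (hab : ∀ s t : ℤ, (∀ k, s * a k + t * b k = 0) → s = 0 ∧ t = 0)
    (e e' : Fin n ⊕ Fin n → ℕ) (h : ∀ k, e k = 0 ∨ e' k = 0)
    (he : ∀ k, (e k : ℤ) - e' k = a k)
    (f f' : Fin n ⊕ Fin n → ℕ) (hf : ∀ k, (f' k : ℤ) - f k = b k) (d : ℕ) :
    ∀ G, mon e + mon e' ∣ G * (mon f + d * mon f') → mon e + mon e' ∣ G := by
  classical
  obtain ⟨w, hw, hw'⟩ := exists_weight a b hab
  let := MvPolynomial.weightedGradedAlgebra (R := ℤ) w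
  let g : GradedRing (fun i => (MvPolynomial.weightedHomogeneousSubmodule ℤ w i).toAddSubgroup) :=
    { one_mem := SetLike.GradedOne.one_mem (A := MvPolynomial.weightedHomogeneousSubmodule ℤ w)
      mul_mem := fun {i j a b} ha hb => 
        SetLike.GradedMul.mul_mem (A := MvPolynomial.weightedHomogeneousSubmodule ℤ w) ha hb
      decompose' := (MvPolynomial.weightedDecomposition ℤ w).decompose'
      left_inv := (MvPolynomial.weightedDecomposition ℤ w).left_inv
      right_inv := (MvPolynomial.weightedDecomposition ℤ w).right_inv }
  refine graded_nz (fun i => (MvPolynomial.weightedHomogeneousSubmodule ℤ w i).toAddSubgroup)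
    (r := ∑ k, (e k : ℤ) * w k) (e := ∑ k, (f k : ℤ) * w k) (δ := ∑ k, b k * w k) ?_ ?_ ?_ hw' ?_
  · refine (MvPolynomial.weightedHomogeneousSubmodule ℤ w _).add_mem (mon_homog w e) ?_
    have h0 : ∑ k, (e k : ℤ) * w k - ∑ k, (e' k : ℤ) * w k = 0 := by
      rw [← hw, ← Finset.sum_sub_distrib]
      exact Finset.sum_congr rfl fun k _ => by rw [← he]; ring
    rw [sub_eq_zero] at h0
    rw [h0]
    exact mon_homog w e'
  · exact mon_homog w f
  · have h1 : ∑ k, (f k : ℤ) * w k + ∑ k, b k * w k = 0 + ∑ k, (f' k : ℤ) * w k := by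
      rw [zero_add, ← Finset.sum_add_distrib]
      exact Finset.sum_congr rfl fun k _ => by rw [← hf]; ring
    rw [h1]
    exact (MvPolynomial.isWeightedHomogeneous_C w (d : ℤ)).mul (mon_homog w f')
  · exact mon_nz _ (binom_not_dvd e e' h) f

theorem poly_ext {n : ℕ} (f g : MvPolynomial (Fin n ⊕ Fin n) ℤ)
    (h : ∀ x : Fin n ⊕ Fin n → ℝ, (∀ k, 0 < x k) →
      MvPolynomial.aeval x f = MvPolynomial.aeval x g) : f = g := by
  apply MvPolynomial.map_injective (Int.castRingHom ℝ) Int.cast_injective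
  apply MvPolynomial.funext_set (fun _ => Set.Ioi (0:ℝ)) (fun _ => Set.Ioi_infinite 0)
  intro x hx
  have := h x (fun k => hx k trivial)
  rw [MvPolynomial.eval_map, MvPolynomial.eval_map]
  exact this

theorem exists_embed (n : ℕ) : ∃ φ : FractionRing (MvPolynomial (Fin n ⊕ Fin n) ℚ) →+* ℝ,
    ∀ k, 0 < φ (algebraMap (MvPolynomial (Fin n ⊕ Fin n) ℚ) _ (MvPolynomial.X k)) := by
  classical
  obtain ⟨s, hs⟩ := exists_isTranscendenceBasis ℚ ℝ
  have hinf : s.Infinite := by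
    intro hfin
    have : Countable s := hfin.countable
    have halg := hs.isAlgebraic
    have h1 := Algebra.IsAlgebraic.cardinalMk_le_max
      (Algebra.adjoin ℚ (Set.range ((↑) : s → ℝ))) ℝ
    have h2 : Cardinal.mk (Algebra.adjoin ℚ (Set.range ((↑) : s → ℝ))) ≤ Cardinal.aleph0 := by
      rw [← Cardinal.mk_congr hs.1.aevalEquiv.toEquiv]
      refine MvPolynomial.cardinalMk_le_max.trans ?_
      simp
    rw [max_eq_right h2] at h1
    rw [Cardinal.mk_real] at h1
    exact absurd Cardinal.aleph0_lt_continuum (not_lt.2 h1)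
  have := hinf.to_subtype
  obtain ⟨g⟩ : Nonempty (Fin n ⊕ Fin n ↪ s) := by
    obtain ⟨e⟩ := Fintype.truncEquivFin (Fin n ⊕ Fin n)
    exact ⟨e.toEmbedding.trans (Fin.valEmbedding.trans (Infinite.natEmbedding s))⟩
  have hx := hs.1.comp g g.injective
  set x : Fin n ⊕ Fin n → ℝ := fun k => (g k : ℝ) with hxdef
  have hx0 : ∀ k, x k ≠ 0 := fun k => hx.ne_zero k
  let ε : Fin n ⊕ Fin n → ℚ := fun k => if 0 < x k then 1 else -1
  have hεε : ∀ k, ε k * ε k = 1 := fun k => by simp only [ε]; split_ifs <;> norm_num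
  let τ : MvPolynomial (Fin n ⊕ Fin n) ℚ →ₐ[ℚ] MvPolynomial (Fin n ⊕ Fin n) ℚ :=
    MvPolynomial.aeval (fun k => MvPolynomial.C (ε k) * MvPolynomial.X k)
  have hτ : ∀ f, τ (τ f) = f := by
    intro f
    have : τ.comp τ = AlgHom.id _ _ := by
      apply MvPolynomial.algHom_ext
      intro k
      simp only [τ, AlgHom.comp_apply, MvPolynomial.aeval_X, map_mul, AlgHom.id_apply,
        MvPolynomial.aeval_C, MvPolynomial.algebraMap_eq]
      rw [← mul_assoc, ← map_mul, hεε, map_one, one_mul]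
    exact DFunLike.congr_fun this f
  let ψ : MvPolynomial (Fin n ⊕ Fin n) ℚ →+* ℝ := ((MvPolynomial.aeval x).comp τ).toRingHom
  have hψ : Function.Injective ψ := by
    refine Function.Injective.comp (g := MvPolynomial.aeval x) hx ?_
    exact Function.LeftInverse.injective hτ
  refine ⟨IsFractionRing.lift (g := ψ) hψ, fun k => ?_⟩
  rw [IsFractionRing.lift_algebraMap]
  change 0 < MvPolynomial.aeval x (τ (MvPolynomial.X k))
  simp only [τ, MvPolynomial.aeval_X, map_mul, MvPolynomial.aeval_C]
  simp only [ε]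
  split_ifs with h
  · simpa using h
  · have := lt_of_le_of_ne (not_lt.1 h) (hx0 k)
    simpa using this

def fm {K : Type*} [Field K] {n : ℕ} (e : Fin n ⊕ Fin n → ℤ) (x : Fin n ⊕ Fin n → K) : K :=
  ∏ k, x k ^ e k

def gmut {K : Type*} [Field K] {n : ℕ} (x : Fin n ⊕ Fin n → K)
    (A : Matrix (Fin n ⊕ Fin n) (Fin n) ℤ) (k : Fin n) : Fin n ⊕ Fin n → K :=
  Function.update x (Sum.inl k) ((x (Sum.inl k))⁻¹ *
    (fm (fun s => max (A s k) 0) x + fm (fun s => max (-A s k) 0) x))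

theorem zpow_max {K : Type*} [Field K] (x : K) (a : ℤ) : x ^ a.toNat = x ^ (max a 0) := by
  rw [← zpow_natCast, Int.toNat_eq_max]

theorem seedMutX_eq {n : ℕ} (x : Fin n ⊕ Fin n → CField n)
    (A : Matrix (Fin n ⊕ Fin n) (Fin n) ℤ) (k : Fin n) : seedMutX x A k = gmut x A k := by
  funext s
  rcases s with i | i
  · by_cases h : i = k
    · subst h
      simp only [seedMutX, gmut, fm, if_true, Function.update_self, Fintype.prod_sum_type, zpow_max]
    · simp [seedMutX, gmut, h]
  · simp [seedMutX, gmut]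

abbrev Om (n : ℕ) : Type := {x : Fin n ⊕ Fin n → ℝ // ∀ k, 0 < x k}

def LR (n : ℕ) : Subring (Om n → ℝ) where
  carrier := {g | ∃ (f : MvPolynomial (Fin n ⊕ Fin n) ℤ) (d : Fin n → ℕ), ∀ x : Om n,
    g x * ∏ i, x.1 (Sum.inl i) ^ d i = MvPolynomial.aeval x.1 f}
  one_mem' := ⟨1, 0, fun x => by simp⟩
  zero_mem' := ⟨0, 0, fun x => by simp⟩
  mul_mem' := by
    rintro g g' ⟨f, d, h⟩ ⟨f', d', h'⟩
    refine ⟨f * f', d + d', fun x => ?_⟩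
    rw [map_mul, ← h, ← h']
    simp only [Pi.add_apply, pow_add, Finset.prod_mul_distrib, Pi.mul_apply]
    ring
  add_mem' := by
    rintro g g' ⟨f, d, h⟩ ⟨f', d', h'⟩
    refine ⟨f * ∏ i, MvPolynomial.X (Sum.inl i) ^ d' i
      + f' * ∏ i, MvPolynomial.X (Sum.inl i) ^ d i, d + d', fun x => ?_⟩
    rw [map_add, map_mul, map_mul, ← h, ← h']
    simp only [Pi.add_apply, pow_add, Finset.prod_mul_distrib, map_prod, map_pow,
      MvPolynomial.aeval_X]
    ring
  neg_mem' := by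
    rintro g ⟨f, d, h⟩
    refine ⟨-f, d, fun x => ?_⟩
    rw [map_neg, ← h]
    simp

def FM {n : ℕ} (e : Fin n ⊕ Fin n → ℤ) : Om n → ℝ := fun x => fm e x.1

theorem FM_pos {n : ℕ} (e : Fin n ⊕ Fin n → ℤ) (x : Om n) : 0 < FM e x :=
  by
  unfold FM fm
  exact Finset.prod_pos fun k _ => zpow_pos (x.2 k) _

theorem FM_mul {n : ℕ} (e e' : Fin n ⊕ Fin n → ℤ) : FM e * FM e' = FM (e + e') := by
  funext x
  simp only [Pi.mul_apply, FM, fm, ← Finset.prod_mul_distrib]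
  exact Finset.prod_congr rfl fun k _ => (zpow_add₀ (x.2 k).ne' _ _).symm

theorem FM_zero {n : ℕ} : FM (0 : Fin n ⊕ Fin n → ℤ) = 1 := by
  funext x
  simp [FM, fm]

theorem FM_pow {n : ℕ} (e : Fin n ⊕ Fin n → ℤ) (d : ℕ) : FM e ^ d = FM (d • e) := by
  induction d with
  | zero => simp [FM_zero]
  | succ d ih => rw [pow_succ, ih, FM_mul, succ_nsmul]

theorem FM_single {n : ℕ} (s : Fin n ⊕ Fin n) (m : ℤ) (x : Om n) :
    FM (Pi.single s m) x = x.1 s ^ m := by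
  simp only [FM, fm]
  rw [Finset.prod_eq_single s]
  · simp
  · intro b _ hb; simp [hb]
  · simp

theorem FM_nat {n : ℕ} (e : Fin n ⊕ Fin n → ℕ) (x : Om n) :
    FM (fun k => (e k : ℤ)) x = MvPolynomial.aeval x.1 (mon e) := by
  simp [FM, fm, mon]

theorem FM_mem {n : ℕ} (e : Fin n ⊕ Fin n → ℤ) (he : ∀ k, 0 ≤ e (Sum.inr k)) : FM e ∈ LR n := by
  refine ⟨mon (fun k => (e k).toNat), fun i => (-e (Sum.inl i)).toNat, fun x => ?_⟩
  rw [← FM_nat]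
  simp only [FM, fm, Fintype.prod_sum_type]
  rw [mul_right_comm, ← Finset.prod_mul_distrib]
  congr 1
  · refine Finset.prod_congr rfl fun k _ => ?_
    rw [← zpow_natCast, ← zpow_add₀ (x.2 _).ne']
    congr 1
    omega
  · refine Finset.prod_congr rfl fun k _ => ?_
    rw [Int.toNat_of_nonneg (he k)]

theorem LR_aeval {n : ℕ} (Φ : Om n → Om n) (hΦ : ∀ k, (fun x => (Φ x).1 k) ∈ LR n)
    (f : MvPolynomial (Fin n ⊕ Fin n) ℤ) : (fun x => MvPolynomial.aeval (Φ x).1 f) ∈ LR n := by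
  induction f using MvPolynomial.induction_on with
  | C a =>
    simp only [MvPolynomial.aeval_C]
    exact intCast_mem (LR n) a
  | add p q hp hq =>
    simp only [map_add]
    exact (LR n).add_mem hp hq
  | mul_X p k hp =>
    simp only [map_mul, MvPolynomial.aeval_X]
    exact (LR n).mul_mem hp (hΦ k)

theorem LR_comp {n : ℕ} (Φ : Om n → Om n) (hΦ : ∀ k, (fun x => (Φ x).1 k) ∈ LR n)
    (g : Om n → ℝ) (hg : g ∈ LR n) : ∃ d : Fin n → ℕ,
    (fun x => g (Φ x) * ∏ i, (Φ x).1 (Sum.inl i) ^ d i) ∈ LR n := by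
  obtain ⟨f, d, h⟩ := hg
  refine ⟨d, ?_⟩
  simp only [h]
  exact LR_aeval Φ hΦ f

def NZ {n : ℕ} (p U : Om n → ℝ) : Prop := ∀ g ∈ LR n, p⁻¹ * g * U ∈ LR n → p⁻¹ * g ∈ LR n

theorem NZ_mul {n : ℕ} {p U V : Om n → ℝ} (hUm : U ∈ LR n) (hU : NZ p U) (hV : NZ p V) :
    NZ p (U * V) := by
  intro g hg h
  apply hU g hg
  rw [mul_assoc]
  apply hV _ ((LR n).mul_mem hg hUm)
  convert! h using 1
  ring

theorem NZ_factor {n : ℕ} {p U V : Om n → ℝ} (hV : V ∈ LR n) (h : NZ p (U * V)) : NZ p U := by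
  intro g hg h1
  apply h g hg
  rw [← mul_assoc]
  exact (LR n).mul_mem h1 hV

theorem NZ_add {n : ℕ} {p U h : Om n → ℝ} (hp : ∀ x, p x ≠ 0) (hh : h ∈ LR n) (hU : NZ p U) :
    NZ p (U + p * h) := by
  intro g hg h1
  apply hU g hg
  have : p⁻¹ * g * U = p⁻¹ * g * (U + p * h) - g * h := by
    funext x
    have := hp x
    simp only [Pi.mul_apply, Pi.sub_apply, Pi.add_apply, Pi.inv_apply]
    field_simp
    ring
  rw [this]
  exact (LR n).sub_mem h1 ((LR n).mul_mem hg hh)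

theorem NZ_pow {n : ℕ} {p U : Om n → ℝ} (hUm : U ∈ LR n) (hU : NZ p U) (b : ℕ) :
    NZ p (U ^ b) := by
  induction b with
  | zero => intro g hg h; simpa using h
  | succ b ih => rw [pow_succ]; exact NZ_mul ((LR n).pow_mem hUm b) ih hU

theorem NZ_final {n : ℕ} {p W z : Om n → ℝ} (hp : ∀ x, p x ≠ 0) (hW : NZ p W) (hWm : W ∈ LR n)
    (hpm : p ∈ LR n) (a : ℕ) (h1 : z * p ^ a ∈ LR n) (h2 : z * W ∈ LR n) : z ∈ LR n := by
  induction a with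
  | zero => simpa using h1
  | succ a ih =>
    apply ih
    have e : z * p ^ a = p⁻¹ * (z * p ^ (a + 1)) := by
      funext x
      have := hp x
      simp only [Pi.mul_apply, Pi.pow_apply, Pi.inv_apply]
      field_simp
      ring
    rw [e]
    apply hW _ h1
    rw [← e]
    have : z * p ^ a * W = z * W * p ^ a := by ring
    rw [this]
    exact (LR n).mul_mem h2 ((LR n).pow_mem hpm a)

/-- the new variable as a function -/
def pf {n : ℕ} (A : Matrix (Fin n ⊕ Fin n) (Fin n) ℤ) (i : Fin n) : Om n → ℝ :=
  FM (Pi.single (Sum.inl i) (-1)) *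
    (FM (fun s => max (A s i) 0) + FM (fun s => max (-A s i) 0))

theorem pf_pos {n : ℕ} (A : Matrix (Fin n ⊕ Fin n) (Fin n) ℤ) (i : Fin n) (x : Om n) :
    0 < pf A i x := mul_pos (FM_pos _ _) (add_pos (FM_pos _ _) (FM_pos _ _))

theorem pf_mem {n : ℕ} (A : Matrix (Fin n ⊕ Fin n) (Fin n) ℤ) (i : Fin n) : pf A i ∈ LR n :=
  (LR n).mul_mem (FM_mem _ (by simp)) ((LR n).add_mem (FM_mem _ (by simp)) (FM_mem _ (by simp)))

theorem pf_NZ_of_poly {n : ℕ} (A : Matrix (Fin n ⊕ Fin n) (Fin n) ℤ) (i : Fin n)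
    (Q : MvPolynomial (Fin n ⊕ Fin n) ℤ)
    (hQ : ∀ G, mon (fun s => (A s i).toNat) + mon (fun s => (-A s i).toNat) ∣ G * Q →
      mon (fun s => (A s i).toNat) + mon (fun s => (-A s i).toNat) ∣ G) :
    NZ (pf A i) (fun x => MvPolynomial.aeval x.1 Q) := by
  rintro g ⟨G, d, hG⟩ ⟨H, d', hH⟩
  set P := mon (fun s => (A s i).toNat) + mon (fun s => (-A s i).toNat) with hP
  have hpP : ∀ x : Om n, pf A i x = (x.1 (Sum.inl i))⁻¹ * MvPolynomial.aeval x.1 P := by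
    intro x
    rw [hP, map_add, ← FM_nat, ← FM_nat]
    simp only [pf, Pi.mul_apply, Pi.add_apply, FM_single, zpow_neg_one, Int.toNat_eq_max]
  have hmon : ∀ (d : Fin n → ℕ) (x : Om n), ∏ i, x.1 (Sum.inl i) ^ d i
      = MvPolynomial.aeval x.1 (mon (Sum.elim d 0)) := by
    intro d x
    simp [mon, Fintype.prod_sum_type]
  have hmnz := fun e => mon_nz P (binom_not_dvd _ _ (fun k => by omega)) e
  have hXnz := mon_nz_X P (Sum.inl i) (binom_not_dvd _ _ (fun k => by omega) _)
  have hppos := pf_pos A i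
  have key : G * Q * mon (Sum.elim d' 0) * MvPolynomial.X (Sum.inl i)
      = P * H * mon (Sum.elim d 0) := by
    apply poly_ext
    intro x hx
    have h1 := hG ⟨x, hx⟩
    have m1 := hmon d ⟨x, hx⟩
    have m2 := hmon d' ⟨x, hx⟩
    simp only at m1 m2
    have h2 := hH ⟨x, hx⟩
    have h3 := hpP ⟨x, hx⟩
    have h4 := hppos ⟨x, hx⟩
    simp only [Pi.mul_apply, Pi.inv_apply] at h1 h2 h3 h4
    simp only [map_mul, MvPolynomial.aeval_X]
    rw [← m1, ← m2]
    rw [← h1, ← h2]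
    have hxi := hx (Sum.inl i)
    have h5 : MvPolynomial.aeval x P = pf A i ⟨x, hx⟩ * x (Sum.inl i) := by
      rw [h3]; field_simp
    rw [h5]
    field_simp
  have hdvd : P ∣ G := by
    apply hQ
    apply hmnz (Sum.elim d' 0)
    apply hXnz
    rw [key, mul_assoc]
    exact dvd_mul_right _ _
  obtain ⟨G', rfl⟩ := hdvd
  refine ⟨G' * MvPolynomial.X (Sum.inl i), d, fun x => ?_⟩
  have h1 := hG x
  have h3 := hpP x
  have h4 := hppos x
  have hxi := x.2 (Sum.inl i)
  simp only [Pi.mul_apply, Pi.inv_apply, map_mul, MvPolynomial.aeval_X] at h1 ⊢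
  rw [mul_assoc, h1]
  have h5 : MvPolynomial.aeval x.1 P = pf A i x * x.1 (Sum.inl i) := by
    rw [h3]; field_simp
  rw [h5]
  field_simp

theorem NZ_FM {n : ℕ} (A : Matrix (Fin n ⊕ Fin n) (Fin n) ℤ) (i : Fin n)
    (e : Fin n ⊕ Fin n → ℤ) : NZ (pf A i) (FM e) := by
  have h1 := pf_NZ_of_poly A i (mon (fun k => (e k).toNat))
    (mon_nz _ (binom_not_dvd _ _ (fun k => by omega)) _)
  simp only [← FM_nat] at h1
  have e2 : FM (fun k => ((e k).toNat : ℤ)) = FM e * FM (fun k => ((-e k).toNat : ℤ)) := by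
    rw [FM_mul]; congr 1; funext k; simp only [Pi.add_apply]; omega
  refine NZ_factor (V := FM (fun k => ((-e k).toNat : ℤ))) (FM_mem _ (fun k => by simp)) ?_
  rw [← e2]
  exact h1

theorem NZ_binom {n : ℕ} (A : Matrix (Fin n ⊕ Fin n) (Fin n) ℤ) (i j : Fin n)
    (hab : ∀ s t : ℤ, (∀ k, s * A k i + t * A k j = 0) → s = 0 ∧ t = 0)
    (f f' : Fin n ⊕ Fin n → ℤ) (hf0 : ∀ k, 0 ≤ f k) (hf0' : ∀ k, 0 ≤ f' k)
    (hf : ∀ k, f' k - f k = A k j) (d : ℕ) :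
    NZ (pf A i) (FM f + (d : Om n → ℝ) * FM f') := by
  have h1 := pf_NZ_of_poly A i (mon (fun k => (f k).toNat) + d * mon (fun k => (f' k).toNat))
    (binom_nz (fun k => A k i) (fun k => A k j) hab _ _ (fun k => by omega)
      (fun k => by omega) _ _ (fun k => by have := hf0 k; have := hf0' k; have := hf k; omega) d)
  simp only [map_add, map_mul, ← FM_nat, map_natCast] at h1
  have e1 : (fun k => ((f k).toNat : ℤ)) = f := by
    funext k; have := hf0 k; omega
  have e2 : (fun k => ((f' k).toNat : ℤ)) = f' := by
    funext k; have := hf0' k; omega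
  rw [e1, e2] at h1
  exact h1

structure Good {n : ℕ} (A : Matrix (Fin n ⊕ Fin n) (Fin n) ℤ) : Prop where
  skew : ∃ d : Fin n → ℤ, (∀ i, 0 < d i) ∧
    ∀ i j, A (Sum.inl i) j * d j = -A (Sum.inl j) i * d i
  indep : ∀ v : Fin n → ℤ, (∀ s, ∑ j, A s j * v j = 0) → v = 0

theorem Good.diag {n : ℕ} {A : Matrix (Fin n ⊕ Fin n) (Fin n) ℤ} (h : Good A) (i : Fin n) :
    A (Sum.inl i) i = 0 := by
  obtain ⟨d, hd, hs⟩ := h.skew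
  have h1 := hs i i
  have h2 := hd i
  have : A (Sum.inl i) i * d i = 0 := by linarith
  rcases mul_eq_zero.1 this with h | h
  · exact h
  · omega

theorem Good.sign {n : ℕ} {A : Matrix (Fin n ⊕ Fin n) (Fin n) ℤ} (h : Good A) (i j : Fin n) :
    (A (Sum.inl i) j = 0 ∧ A (Sum.inl j) i = 0) ∨ (A (Sum.inl i) j < 0 ∧ 0 < A (Sum.inl j) i) ∨
    (0 < A (Sum.inl i) j ∧ A (Sum.inl j) i < 0) := by
  obtain ⟨d, hd, hs⟩ := h.skew
  have h1 := hs i j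
  have h2 := hd i
  have h3 := hd j
  rcases lt_trichotomy (A (Sum.inl i) j) 0 with h | h | h
  · right; left
    refine ⟨h, ?_⟩
    by_contra hc
    nlinarith
  · left
    refine ⟨h, ?_⟩
    rw [h, zero_mul] at h1
    rcases mul_eq_zero.1 h1.symm with h4 | h4 <;> omega
  · right; right
    refine ⟨h, ?_⟩
    by_contra hc
    nlinarith

theorem Good.neg {n : ℕ} {A : Matrix (Fin n ⊕ Fin n) (Fin n) ℤ} (h : Good A) : Good (-A) := by
  obtain ⟨d, hd, hs⟩ := h.skew
  refine ⟨⟨d, hd, fun i j => ?_⟩, fun v hv => h.indep v fun s => ?_⟩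
  · have := hs i j
    simp only [Matrix.neg_apply]
    linarith
  · have := hv s
    simp only [Matrix.neg_apply, neg_mul, Finset.sum_neg_distrib] at this
    linarith

theorem mm_k {n : ℕ} (A : Matrix (Fin n ⊕ Fin n) (Fin n) ℤ) (k : Fin n) (s) :
    matMutate Sum.inl A k s k = -A s k := by simp [matMutate]

theorem mm_row {n : ℕ} (A : Matrix (Fin n ⊕ Fin n) (Fin n) ℤ) (k j : Fin n) :
    matMutate Sum.inl A k (Sum.inl k) j = -A (Sum.inl k) j := by simp [matMutate]

theorem mm_ne {n : ℕ} (A : Matrix (Fin n ⊕ Fin n) (Fin n) ℤ) (k j : Fin n) (s)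
    (h1 : s ≠ Sum.inl k) (h2 : j ≠ k) :
    matMutate Sum.inl A k s j
      = A s j + A s k * max (A (Sum.inl k) j) 0 + max (-A s k) 0 * A (Sum.inl k) j := by
  simp [matMutate, h1, h2]

theorem max_id (a b : ℤ) : a * max (-b) 0 + max a 0 * b = a * max b 0 + max (-a) 0 * b := by
  have h1 : max (-b) 0 = max b 0 - b := by omega
  have h2 : max (-a) 0 = max a 0 - a := by omega
  rw [h1, h2]; ring

theorem mm_mm {n : ℕ} (A : Matrix (Fin n ⊕ Fin n) (Fin n) ℤ) (k : Fin n) :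
    matMutate Sum.inl (matMutate Sum.inl A k) k = A := by
  ext s j
  by_cases h1 : s = Sum.inl k
  · subst h1; simp [mm_row]
  by_cases h2 : j = k
  · subst h2; simp [mm_k]
  rw [mm_ne _ _ _ _ h1 h2, mm_ne _ _ _ _ h1 h2, mm_k, mm_row]
  have := max_id (A s k) (A (Sum.inl k) j)
  rw [neg_neg]
  linarith

theorem mm_neg {n : ℕ} (A : Matrix (Fin n ⊕ Fin n) (Fin n) ℤ) (k : Fin n) :
    matMutate Sum.inl (-A) k = -matMutate Sum.inl A k := by
  ext s j
  rw [Matrix.neg_apply]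
  by_cases h1 : s = Sum.inl k
  · subst h1; simp [mm_row]
  by_cases h2 : j = k
  · subst h2; simp [mm_k]
  rw [mm_ne _ _ _ _ h1 h2, mm_ne _ _ _ _ h1 h2]
  simp only [Matrix.neg_apply]
  have := max_id (A s k) (A (Sum.inl k) j)
  rw [neg_neg]
  linarith

theorem Good.mm {n : ℕ} {A : Matrix (Fin n ⊕ Fin n) (Fin n) ℤ} (h : Good A) (k : Fin n) :
    Good (matMutate Sum.inl A k) := by
  have hkk := h.diag k
  obtain ⟨d, hd, hs⟩ := h.skew
  refine ⟨⟨d, hd, fun i j => ?_⟩, fun v hv => ?_⟩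
  · by_cases h1 : i = k
    · subst h1
      rw [mm_row, mm_k]
      have := hs i j
      linarith
    by_cases h2 : j = k
    · subst h2
      rw [mm_row, mm_k]
      have := hs i j
      linarith
    rw [mm_ne _ _ _ _ (by simpa using h1) h2, mm_ne _ _ _ _ (by simpa using h2) h1]
    have e1 := hs i j
    have e2 := hs k i
    have e3 := hs j k
    set a := A (Sum.inl i) k
    set b := A (Sum.inl k) j
    set a' := A (Sum.inl k) i
    set b' := A (Sum.inl j) k
    have hi := hd i
    have hj := hd j
    have hk := hd k
    have f1 : max a' 0 * d i = max (-a) 0 * d k := by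
      rw [max_mul_of_nonneg _ _ hi.le, max_mul_of_nonneg _ _ hk.le, e2]; simp
    have f2 : max (-b') 0 * d k = max b 0 * d j := by
      rw [max_mul_of_nonneg _ _ hk.le, max_mul_of_nonneg _ _ hj.le]
      congr 1
      · linarith
      · simp
    apply mul_right_cancel₀ hk.ne'
    have g1 : b' * max a' 0 * d i * d k = -(b * d j) * (max (-a) 0 * d k) := by
      rw [← f1, show -(b * d j) = b' * d k by linarith]; ring
    have g2 : max (-b') 0 * a' * d i * d k = max b 0 * d j * (-a * d k) := by
      rw [← f2, ← e2]; ring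
    linear_combination d k * e1 + g1 + g2
  · have hrow : ∑ j, A (Sum.inl k) j * v j = 0 := by
      have := hv (Sum.inl k)
      simp only [mm_row, neg_mul, Finset.sum_neg_distrib] at this
      linarith
    set t := ∑ j, max (A (Sum.inl k) j) 0 * v j with ht
    have hw := h.indep (Function.update v k (-v k + t)) (fun s => ?_)
    · have h0 : ∀ j, j ≠ k → v j = 0 := by
        intro j hj
        have := congrFun hw j
        simpa [hj] using this
      have ht0 : t = 0 := by
        rw [ht]
        apply Finset.sum_eq_zero
        intro j _
        by_cases hj : j = k
        · subst hj; simp [hkk]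
        · simp [h0 j hj]
      funext j
      by_cases hj : j = k
      · subst hj
        have := congrFun hw j
        simpa [ht0] using this
      · exact h0 j hj
    · have hupd : ∀ B : Fin n → ℤ, ∑ j, B j * Function.update v k (-v k + t) j
          = ∑ j, B j * v j + B k * (-2 * v k + t) := by
        intro B
        rw [← Finset.add_sum_erase _ _ (Finset.mem_univ k),
          ← Finset.add_sum_erase _ (fun j => B j * v j) (Finset.mem_univ k)]
        have : ∑ x ∈ Finset.univ.erase k, B x * Function.update v k (-v k + t) x
            = ∑ x ∈ Finset.univ.erase k, B x * v x := by
          refine Finset.sum_congr rfl fun x hx => ?_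
          rw [Function.update_of_ne (Finset.ne_of_mem_erase hx)]
        rw [this, Function.update_self]
        ring
      rw [hupd]
      by_cases h1 : s = Sum.inl k
      · subst h1; rw [hrow, hkk]; ring
      have hvs := hv s
      have hterm : ∀ j, matMutate Sum.inl A k s j * v j
          = A s j * v j + A s k * (max (A (Sum.inl k) j) 0 * v j)
            + max (-A s k) 0 * (A (Sum.inl k) j * v j)
            + (if j = k then -2 * A s k * v k else 0) := by
        intro j
        by_cases h2 : j = k
        · subst h2; rw [mm_k, hkk]; simp; ring
        · rw [mm_ne _ _ _ _ h1 h2]; simp [h2]; ring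
      simp only [hterm, Finset.sum_add_distrib, ← Finset.mul_sum, hrow, ← ht] at hvs
      simp at hvs
      linarith

theorem Good.pair {n : ℕ} {A : Matrix (Fin n ⊕ Fin n) (Fin n) ℤ} (h : Good A) {i j : Fin n}
    (hij : i ≠ j) (s t : ℤ) (hst : ∀ k, s * A k i + t * A k j = 0) : s = 0 ∧ t = 0 := by
  have := h.indep (Pi.single i s + Pi.single j t) (fun k => by
    simp only [Pi.add_apply, mul_add, Finset.sum_add_distrib, Pi.single_apply, mul_ite, mul_zero,
      Finset.sum_ite_eq', Finset.mem_univ, if_true]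
    have := hst k
    linarith)
  have h1 := congrFun this i
  have h2 := congrFun this j
  simp [hij, hij.symm] at h1 h2
  exact ⟨h1, h2⟩

theorem good_principal {n : ℕ} (B : Matrix (Fin n) (Fin n) ℤ)
    (hskew : ∃ d : Fin n → ℤ, (∀ i, 0 < d i) ∧ ∀ i j, B i j * d j = -B j i * d i) :
    Good (principalExt B) := by
  refine ⟨hskew, fun v hv => ?_⟩
  funext i
  have := hv (Sum.inr i)
  simpa [principalExt] using this

theorem gmut_neg {K : Type*} [Field K] {n : ℕ} (x : Fin n ⊕ Fin n → K)
    (A : Matrix (Fin n ⊕ Fin n) (Fin n) ℤ) (k : Fin n) : gmut x (-A) k = gmut x A k := by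
  simp only [gmut, Matrix.neg_apply, neg_neg]
  rw [add_comm]

theorem fm_update {K : Type*} [Field K] {n : ℕ} (e : Fin n ⊕ Fin n → ℤ) (x : Fin n ⊕ Fin n → K)
    (s : Fin n ⊕ Fin n) (v : K) :
    fm e (Function.update x s v) = v ^ e s * fm (Function.update e s 0) x := by
  unfold fm
  rw [← Finset.mul_prod_erase _ _ (Finset.mem_univ s),
    ← Finset.mul_prod_erase _ (fun k => x k ^ Function.update e s 0 k) (Finset.mem_univ s)]
  simp only [Function.update_self, zpow_zero, one_mul]
  congr 1
  refine Finset.prod_congr rfl fun k hk => ?_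
  rw [Function.update_of_ne (Finset.ne_of_mem_erase hk),
    Function.update_of_ne (Finset.ne_of_mem_erase hk)]

theorem gmut_at {n : ℕ} (A : Matrix (Fin n ⊕ Fin n) (Fin n) ℤ) (k : Fin n) (x : Om n) :
    gmut x.1 A k (Sum.inl k) = pf A k x := by
  simp [gmut, pf, FM_single]
  simp [FM]

theorem gmut_eq {n : ℕ} (A : Matrix (Fin n ⊕ Fin n) (Fin n) ℤ) (k : Fin n) (x : Om n) :
    gmut x.1 A k = Function.update x.1 (Sum.inl k) (pf A k x) := by
  rw [← gmut_at]; simp [gmut]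

def mutO {n : ℕ} (A : Matrix (Fin n ⊕ Fin n) (Fin n) ℤ) (k : Fin n) (x : Om n) : Om n :=
  ⟨gmut x.1 A k, fun s => by
    rw [gmut_eq]
    by_cases h : s = Sum.inl k
    · subst h; simpa using pf_pos A k x
    · simpa [h] using x.2 s⟩

theorem mutO_val {n : ℕ} (A : Matrix (Fin n ⊕ Fin n) (Fin n) ℤ) (k : Fin n) (x : Om n) :
    (mutO A k x).1 = Function.update x.1 (Sum.inl k) (pf A k x) := gmut_eq A k x

theorem FM_mut {n : ℕ} (A : Matrix (Fin n ⊕ Fin n) (Fin n) ℤ) (k : Fin n) (x : Om n)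
    (e : Fin n ⊕ Fin n → ℤ) : FM e (mutO A k x)
      = pf A k x ^ e (Sum.inl k) * FM (Function.update e (Sum.inl k) 0) x := by
  simp only [FM]
  rw [mutO_val, fm_update]

theorem mutO_mutO {n : ℕ} {A : Matrix (Fin n ⊕ Fin n) (Fin n) ℤ} (hA : Good A) (k : Fin n)
    (x : Om n) : mutO (matMutate Sum.inl A k) k (mutO A k x) = x := by
  apply Subtype.ext
  rw [mutO_val, mutO_val, Function.update_idem]
  have : pf (matMutate Sum.inl A k) k (mutO A k x) = x.1 (Sum.inl k) := by
    have hkk := hA.diag k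
    have hp := pf_pos A k x
    have hx := x.2 (Sum.inl k)
    have hu : ∀ e : Fin n ⊕ Fin n → ℤ, e (Sum.inl k) = 0 → Function.update e (Sum.inl k) 0 = e :=
      fun e he => by rw [← he, Function.update_eq_self]
    have : pf (matMutate Sum.inl A k) k (mutO A k x) * pf A k x = x.1 (Sum.inl k) * pf A k x := by
      conv_lhs => rw [pf]
      simp only [Pi.mul_apply, Pi.add_apply, FM_mut, mm_k, hkk, neg_neg, neg_zero, max_self,
        zpow_zero, one_mul, Pi.single_eq_same]
      rw [hu (fun s => max (A s k) 0) (by simp [hkk]), hu (fun s => max (-A s k) 0) (by simp [hkk])]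
      have h0 : FM (Function.update (Pi.single (Sum.inl k) (-1)) (Sum.inl k) 0) x = 1 := by
        rw [show Function.update (Pi.single (Sum.inl k) (-1)) (Sum.inl k) 0
          = (0 : Fin n ⊕ Fin n → ℤ) by simp [Pi.single], FM_zero]
        rfl
      rw [h0, mul_one, zpow_neg_one, mul_right_comm, inv_mul_cancel₀ hp.ne', one_mul]
      simp only [pf, Pi.mul_apply, Pi.add_apply, FM_single, zpow_neg_one]
      field_simp
      ring
    exact mul_right_cancel₀ hp.ne' this
  rw [this, Function.update_eq_self]

def uf {n : ℕ} (A : Matrix (Fin n ⊕ Fin n) (Fin n) ℤ) (i j : Fin n) : Om n → ℝ :=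
  fun x => pf (matMutate Sum.inl A i) j (mutO A i x)

def vf {n : ℕ} (A : Matrix (Fin n ⊕ Fin n) (Fin n) ℤ) (i j : Fin n) : Om n → ℝ :=
  fun x => pf (matMutate Sum.inl (matMutate Sum.inl A i) j) i
    (mutO (matMutate Sum.inl A i) j (mutO A i x))

theorem core {n : ℕ} {A : Matrix (Fin n ⊕ Fin n) (Fin n) ℤ} (hA : Good A) {i j : Fin n}
    (hij : i ≠ j) (hneg : A (Sum.inl i) j ≤ 0) :
    uf A i j ∈ LR n ∧ vf A i j ∈ LR n ∧ NZ (pf A i) (uf A i j) ∧ NZ (pf A i) (vf A i j) := by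
  set A1 := matMutate Sum.inl A i with hA1
  set A2 := matMutate Sum.inl A1 j with hA2
  have hsign := hA.sign i j
  have hii := hA.diag i
  have hjj := hA.diag j
  obtain ⟨c, hc⟩ : ∃ c : ℕ, A (Sum.inl i) j = -c := ⟨(-A (Sum.inl i) j).toNat, by omega⟩
  obtain ⟨d, hd⟩ : ∃ d : ℕ, A (Sum.inl j) i = d := ⟨(A (Sum.inl j) i).toNat, by omega⟩
  have hcd : c = 0 ↔ d = 0 := by omega
  have hne : (Sum.inl j : Fin n ⊕ Fin n) ≠ Sum.inl i := by simpa using hij.symm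
  -- matrix entries
  have a1i : ∀ s, A1 s i = -A s i := fun s => mm_k A i s
  have a1ij : A1 (Sum.inl i) j = c := by rw [hA1, mm_row, hc, neg_neg]
  have a1j : ∀ s, s ≠ Sum.inl i → A1 s j = A s j - c * max (-A s i) 0 := by
    intro s hs
    rw [hA1, mm_ne _ _ _ _ hs hij.symm, hc, max_eq_right (by omega : -(c:ℤ) ≤ 0)]
    ring
  have a1jj : A1 (Sum.inl j) j = 0 := by
    rw [a1j _ hne, hjj, hd, max_eq_right (by omega : -(d:ℤ) ≤ 0)]; ring
  have a1ji : A1 (Sum.inl j) i = -d := by rw [a1i, hd]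
  have a2ji : A2 (Sum.inl j) i = d := by rw [hA2, mm_row, a1ji, neg_neg]
  have a2i : ∀ s, s ≠ Sum.inl j → A2 s i = -A s i - d * max (-A1 s j) 0 := by
    intro s hs
    rw [hA2, mm_ne _ _ _ _ hs hij, a1ji, max_eq_right (by omega : -(d:ℤ) ≤ 0), a1i]
    ring
  have a2ii : A2 (Sum.inl i) i = 0 := by
    rw [a2i _ hne.symm, hii, a1ij, max_eq_right (by omega : -(c:ℤ) ≤ 0)]; ring
  -- exponents
  set p := pf A i with hp
  have hppos : ∀ x, 0 < p x := pf_pos A i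
  have hpm : p ∈ LR n := pf_mem A i
  set xi : Om n → ℝ := FM (Pi.single (Sum.inl i) 1) with hxi
  set Mp : Om n → ℝ := FM (fun s => max (A s i) 0) with hMp
  set Mm : Om n → ℝ := FM (fun s => max (-A s i) 0) with hMm
  let ep : Fin n ⊕ Fin n → ℤ := Function.update (fun s => max (A1 s j) 0) (Sum.inl i) 0
  let em : Fin n ⊕ Fin n → ℤ := fun s => max (-A1 s j) 0
  let iv : Fin n ⊕ Fin n → ℤ := Pi.single (Sum.inl j) (-1)
  let sp : Fin n ⊕ Fin n → ℤ := Function.update (fun s => max (A2 s i) 0) (Sum.inl j) 0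
  let sm : Fin n ⊕ Fin n → ℤ := fun s => max (-A2 s i) 0
  have hup : ∀ (e : Fin n ⊕ Fin n → ℤ) s, e s = 0 → Function.update e s 0 = e :=
      fun e s he => by rw [← he, Function.update_eq_self]
  have hiv : iv (Sum.inl i) = 0 := by simp [iv, hij]
  have hem : em (Sum.inl i) = 0 := by simp only [em, a1ij]; omega
  set a : Om n → ℝ := FM (iv + em) with ha
  set b : Om n → ℝ := FM (iv + ep) with hb
  set Sp : Om n → ℝ := FM sp with hSp
  set Sm : Om n → ℝ := FM sm with hSm
  have ham : a ∈ LR n := FM_mem _ (fun k => by simp [iv, em])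
  have hbm : b ∈ LR n := FM_mem _ (fun k => by simp [iv, ep])
  have hSpm : Sp ∈ LR n := FM_mem _ (fun k => by simp [sp])
  have hSmm : Sm ∈ LR n := FM_mem _ (fun k => by simp [sm])
  have hMpm : Mp ∈ LR n := FM_mem _ (fun k => by simp)
  have hMmm : Mm ∈ LR n := FM_mem _ (fun k => by simp)
  have hxim : xi ∈ LR n := FM_mem _ (fun k => by simp)
  -- p relation
  have hpx : xi * p = Mp + Mm := by
    rw [hp, pf, ← mul_assoc, hxi, FM_mul, ← Pi.single_add]
    simp [FM_zero, hMp, hMm]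
  -- u formula
  have hu : uf A i j = a + p ^ c * b := by
    funext x
    have e0 : uf A i j x = FM iv (mutO A i x) *
        (FM (fun s => max (A1 s j) 0) (mutO A i x) + FM em (mutO A i x)) := rfl
    have e1 : FM iv (mutO A i x) = FM iv x := by
      rw [FM_mut, hup _ _ hiv, hiv, zpow_zero, one_mul]
    have e2 : FM em (mutO A i x) = FM em x := by
      rw [FM_mut, hup _ _ hem, hem, zpow_zero, one_mul]
    have e3 : FM (fun s => max (A1 s j) 0) (mutO A i x) = p x ^ c * FM ep x := by
      rw [FM_mut, a1ij, max_eq_left (by omega : (0:ℤ) ≤ c), zpow_natCast]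
    rw [e0, e1, e2, e3, ha, hb, ← FM_mul, ← FM_mul]
    simp only [Pi.mul_apply, Pi.add_apply, Pi.pow_apply]
    ring
  have hum : uf A i j ∈ LR n := by
    rw [hu]; exact (LR n).add_mem ham ((LR n).mul_mem ((LR n).pow_mem hpm c) hbm)
  -- v formula
  have hspi : sp (Sum.inl i) = 0 := by
    simp only [sp]; rw [Function.update_of_ne hne.symm, a2ii, max_self]
  have hsmi : sm (Sum.inl i) = 0 := by simp [sm, a2ii]
  have hsmj : sm (Sum.inl j) = 0 := by simp only [sm, a2ji]; omega
  have hv : p * vf A i j = uf A i j ^ d * Sp + Sm := by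
    funext x
    have e0 : vf A i j x = FM (Pi.single (Sum.inl i) (-1)) (mutO A1 j (mutO A i x)) *
        (FM (fun s => max (A2 s i) 0) (mutO A1 j (mutO A i x))
          + FM sm (mutO A1 j (mutO A i x))) := rfl
    have e1 : FM sm (mutO A1 j (mutO A i x)) = FM sm x := by
      rw [FM_mut, hup _ _ hsmj, hsmj, FM_mut, hup _ _ hsmi, hsmi]
      simp only [zpow_zero, one_mul]
    have e2 : FM (fun s => max (A2 s i) 0) (mutO A1 j (mutO A i x)) = uf A i j x ^ d * Sp x := by
      rw [FM_mut, a2ji, max_eq_left (by omega : (0:ℤ) ≤ d), zpow_natCast]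
      change uf A i j x ^ d * FM sp (mutO A i x) = _
      rw [FM_mut, hup _ _ hspi, hspi, zpow_zero, one_mul]
    have e3 : FM (Pi.single (Sum.inl i) (-1)) (mutO A1 j (mutO A i x)) = (p x)⁻¹ := by
      rw [FM_single, mutO_val, Function.update_of_ne hne.symm, mutO_val, Function.update_self,
        zpow_neg_one]
    simp only [Pi.mul_apply, Pi.add_apply, Pi.pow_apply]
    rw [e0, e1, e2, e3, ← mul_assoc, mul_inv_cancel₀ (hppos x).ne', one_mul]
  -- monomial identity
  have hmono : a ^ d * Sp * Mp = Sm * Mm := by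
    rw [ha, hSp, hMp, hSm, hMm, FM_pow, FM_mul, FM_mul, FM_mul]
    congr 1
    funext s
    simp only [Pi.add_apply, Pi.smul_apply]
    rw [nsmul_eq_mul]
    by_cases hs : s = Sum.inl j
    · subst hs
      have h1 : iv (Sum.inl j) = -1 := by simp [iv]
      have h2 : em (Sum.inl j) = 0 := by simp [em, a1jj]
      have h3 : sp (Sum.inl j) = 0 := by simp [sp]
      rw [h1, h2, h3, hsmj, hd]
      push_cast
      omega
    · have h1 : iv s = 0 := by simp [iv, hs]
      have h3 : sp s = max (A2 s i) 0 := by simp [sp, hs]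
      have h4 := a2i s hs
      rw [h1, h3]
      simp only [em, sm, zero_add]
      push_cast
      generalize (d : ℤ) * max (-A1 s j) 0 = t at *
      omega
  -- expansion
  obtain ⟨k, hk⟩ := Polynomial.powAddExpansion (⟨a, ham⟩ : LR n)
    ⟨p ^ c * b, (LR n).mul_mem ((LR n).pow_mem hpm c) hbm⟩ d
  have hk' : uf A i j ^ d = a ^ d + (d : Om n → ℝ) * a ^ (d - 1) * (p ^ c * b)
      + k.1 * (p ^ c * b) ^ 2 := by
    rw [hu]; exact congrArg Subtype.val hk
  have hkm := k.2
  generalize k.1 = k' at hk' hkm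
  have hMv : p * (Mp * vf A i j) = p * (Sm * xi) + Mp * Sp *
      ((d : Om n → ℝ) * a ^ (d - 1) * (p ^ c * b) + k' * (p ^ c * b) ^ 2) := by
    have e1 : p * (Mp * vf A i j) = Mp * (p * vf A i j) := by ring
    rw [e1, hv, hk']
    linear_combination hmono - Sm * hpx
  have hpc : ∀ f g : Om n → ℝ, p * f = p * g → f = g := by
    intro f g h
    funext x
    have := congrFun h x
    simp only [Pi.mul_apply] at this
    exact mul_left_cancel₀ (hppos x).ne' this
  have hpne : ∀ x, p x ≠ 0 := fun x => (hppos x).ne'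
  have hdm : (d : Om n → ℝ) ∈ LR n := natCast_mem (LR n) d
  have hvm_of : Mp * vf A i j ∈ LR n → vf A i j ∈ LR n := by
    intro h
    have e1 : vf A i j = p⁻¹ * (p * vf A i j) := by
      funext x
      have := hpne x
      simp only [Pi.mul_apply, Pi.inv_apply]
      field_simp
    rw [e1]
    have hpv : p * vf A i j ∈ LR n := by
      rw [hv]; exact (LR n).add_mem ((LR n).mul_mem ((LR n).pow_mem hum d) hSpm) hSmm
    apply NZ_FM A i (fun s => max (A s i) 0) _ hpv
    rw [← hp, ← e1, mul_comm]
    exact h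
  have hSx : NZ p (Sm * xi) := by rw [hSm, hxi, FM_mul]; exact NZ_FM A i _
  have hSxm : Sm * xi ∈ LR n := (LR n).mul_mem hSmm hxim
  rcases c with _ | c
  · have hd0 : d = 0 := by omega
    subst hd0
    have hMv' : Mp * vf A i j = Sm * xi := by
      have : uf A i j ^ 0 = 1 := pow_zero _
      apply hpc
      have e1 : p * (Mp * vf A i j) = Mp * (p * vf A i j) := by ring
      rw [e1, hv]
      linear_combination hmono - Sm * hpx
    refine ⟨hum, hvm_of (hMv' ▸ hSxm), ?_, ?_⟩
    · have h1 := NZ_binom A i j (hA.pair hij) em ep (fun k => by simp [em])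
        (fun k => by
          simp only [ep]
          by_cases hk : k = Sum.inl i
          · subst hk; simp
          · rw [Function.update_of_ne hk]; simp) (fun k => by
          simp only [ep]
          by_cases hk : k = Sum.inl i
          · subst hk; rw [Function.update_self, hem, hc]; simp
          · rw [Function.update_of_ne hk]
            have := a1j k hk
            simp only [em]
            push_cast at this
            omega) 1
      have h2 := NZ_mul (FM_mem iv (by simp [iv])) (NZ_FM A i iv) h1
      have e : uf A i j = FM iv * (FM em + ((1 : ℕ) : Om n → ℝ) * FM ep) := by
        rw [hu, ha, hb, ← FM_mul, ← FM_mul]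
        push_cast
        ring
      rw [e]; exact h2
    · refine NZ_factor hMpm ?_
      rw [mul_comm, hMv']; exact hSx
  have hMv2 : Mp * vf A i j = Sm * xi + Mp * Sp *
      ((d : Om n → ℝ) * a ^ (d - 1) * (p ^ c * b) + k' * (p ^ c * b) * (p ^ (c + 1) * b)) := by
    apply hpc
    rw [hMv]
    ring
  have hNu : NZ p (uf A i j) := by
    rw [hu, pow_succ', mul_assoc]
    exact NZ_add hpne ((LR n).mul_mem ((LR n).pow_mem hpm c) hbm) (NZ_FM A i _)
  have hvm : vf A i j ∈ LR n := by
    apply hvm_of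
    rw [hMv2]
    refine (LR n).add_mem hSxm ((LR n).mul_mem ((LR n).mul_mem hMpm hSpm) ((LR n).add_mem ?_ ?_))
    · exact (LR n).mul_mem ((LR n).mul_mem hdm ((LR n).pow_mem ham _))
        ((LR n).mul_mem ((LR n).pow_mem hpm c) hbm)
    · exact (LR n).mul_mem ((LR n).mul_mem hkm ((LR n).mul_mem ((LR n).pow_mem hpm c) hbm))
        ((LR n).mul_mem ((LR n).pow_mem hpm _) hbm)
  refine ⟨hum, hvm, hNu, ?_⟩
  rcases c with _ | c
  · -- c = 1
    obtain ⟨d, rfl⟩ : ∃ d', d = d' + 1 := ⟨d - 1, by omega⟩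
    have e : vf A i j * (Mp * a) = Sm * FM iv * (FM (Pi.single (Sum.inl i) 1 + em)
        + ((d + 1 : ℕ) : Om n → ℝ) * FM (ep + fun s => max (-A s i) 0))
        + p * (a * (Mp * Sp) * (k' * b * b)) := by
      have h1 : FM (Pi.single (Sum.inl i) 1 + em) = xi * FM em := by rw [hxi, FM_mul]
      have h2 : FM (ep + fun s => max (-A s i) 0) = FM ep * Mm := by rw [hMm, FM_mul]
      have h3 : a = FM iv * FM em := by rw [ha, FM_mul]
      have h4 : b = FM iv * FM ep := by rw [hb, FM_mul]
      rw [h1, h2]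
      have e1 : vf A i j * (Mp * a) = a * (Mp * vf A i j) := by ring
      rw [e1, hMv2, Nat.add_sub_cancel]
      linear_combination ((d + 1 : ℕ) : Om n → ℝ) * b * hmono + Sm * xi * h3
        + ((d + 1 : ℕ) : Om n → ℝ) * Sm * Mm * h4
    refine NZ_factor (V := Mp * a) ((LR n).mul_mem hMpm ham) ?_
    rw [e]
    have hSiv : Sm * FM iv ∈ LR n := (LR n).mul_mem hSmm (FM_mem iv (by simp [iv]))
    refine NZ_add hpne ?_ (NZ_mul hSiv ?_ ?_)
    · exact (LR n).mul_mem ((LR n).mul_mem ham ((LR n).mul_mem hMpm hSpm))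
        ((LR n).mul_mem ((LR n).mul_mem hkm hbm) hbm)
    · rw [hSm, FM_mul]; exact NZ_FM A i _
    · refine NZ_binom A i j (hA.pair hij) _ _ (fun k => ?_) (fun k => ?_) (fun k => ?_) _
      · simp only [Pi.add_apply, em, Pi.single_apply]
        split_ifs <;> omega
      · simp only [Pi.add_apply, ep, Function.update_apply]
        split_ifs <;> omega
      · simp only [Pi.add_apply, ep]
        by_cases hk : k = Sum.inl i
        · subst hk; rw [Function.update_self, hem, hc, Pi.single_eq_same, hii]; simp
        · rw [Function.update_of_ne hk, Pi.single_eq_of_ne hk]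
          have := a1j k hk
          simp only [em]
          push_cast at this
          omega
  · refine NZ_factor hMpm ?_
    have e : vf A i j * Mp = Sm * xi + p * (Mp * Sp *
      ((d : Om n → ℝ) * a ^ (d - 1) * (p ^ c * b) + k' * (p ^ c * b) * (p ^ (c + 2) * b))) := by
      rw [mul_comm, hMv2]
      ring
    rw [e]
    refine NZ_add hpne ((LR n).mul_mem ((LR n).mul_mem hMpm hSpm) ((LR n).add_mem ?_ ?_)) hSx
    · exact (LR n).mul_mem ((LR n).mul_mem hdm ((LR n).pow_mem ham _))
        ((LR n).mul_mem ((LR n).pow_mem hpm c) hbm)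
    · exact (LR n).mul_mem ((LR n).mul_mem hkm ((LR n).mul_mem ((LR n).pow_mem hpm c) hbm))
        ((LR n).mul_mem ((LR n).pow_mem hpm _) hbm)

theorem pf_neg {n : ℕ} (A : Matrix (Fin n ⊕ Fin n) (Fin n) ℤ) (k : Fin n) :
    pf (-A) k = pf A k := by
  funext x
  rw [← gmut_at, ← gmut_at, gmut_neg]

theorem mutO_neg {n : ℕ} (A : Matrix (Fin n ⊕ Fin n) (Fin n) ℤ) (k : Fin n) :
    mutO (-A) k = mutO A k := by
  funext x
  apply Subtype.ext
  rw [mutO_val, mutO_val, pf_neg]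

theorem core_all {n : ℕ} {A : Matrix (Fin n ⊕ Fin n) (Fin n) ℤ} (hA : Good A) {i j : Fin n}
    (hij : i ≠ j) :
    uf A i j ∈ LR n ∧ vf A i j ∈ LR n ∧ NZ (pf A i) (uf A i j) ∧ NZ (pf A i) (vf A i j) := by
  rcases le_total (A (Sum.inl i) j) 0 with h | h
  · exact core hA hij h
  · have := core hA.neg hij (by simpa using h)
    have hu : uf (-A) i j = uf A i j := by
      funext x
      simp only [uf, mm_neg, pf_neg, mutO_neg]
    have hv : vf (-A) i j = vf A i j := by
      funext x
      simp only [vf, mm_neg, pf_neg, mutO_neg]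
    rwa [hu, hv, pf_neg] at this

theorem LR_strip {n : ℕ} (Φ : Om n → Om n) (hΦ : ∀ k, (fun x => (Φ x).1 k) ∈ LR n)
    (S : Finset (Fin n)) (hS : ∀ i, i ∉ S → ∀ x, (Φ x).1 (Sum.inl i) = x.1 (Sum.inl i))
    (g : Om n → ℝ) (hg : g ∈ LR n) : ∃ d : Fin n → ℕ,
    (fun x => g (Φ x) * ∏ i ∈ S, (Φ x).1 (Sum.inl i) ^ d i) ∈ LR n := by
  obtain ⟨d, h⟩ := LR_comp Φ hΦ g hg
  refine ⟨d, ?_⟩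
  have h2 := (LR n).mul_mem h (FM_mem (Sum.elim (fun i => if i ∈ S then 0 else -(d i : ℤ)) 0)
    (fun k => by simp))
  convert h2 using 1
  funext x
  simp only [Pi.mul_apply, FM, fm, Fintype.prod_sum_type, Sum.elim_inl, Sum.elim_inr, Pi.zero_apply,
    zpow_zero, Finset.prod_const_one, mul_one]
  rw [mul_assoc, ← Finset.prod_mul_distrib, ← Finset.prod_subset (Finset.subset_univ S)]
  · congr 1
    refine Finset.prod_congr rfl fun k hk => ?_
    simp [hk]
  · intro k _ hk
    have := (x.2 (Sum.inl k)).ne'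
    rw [if_neg hk, hS k hk, zpow_neg, zpow_natCast, mul_inv_cancel₀ (pow_ne_zero _ this)]

def clus {n : ℕ} : List (Fin n) → Matrix (Fin n ⊕ Fin n) (Fin n) ℤ → Om n → Om n
  | [], _, x => x
  | k :: L, A, x => clus L (matMutate Sum.inl A k) (mutO A k x)

theorem coord_mem {n : ℕ} (s : Fin n ⊕ Fin n) : (fun x : Om n => x.1 s) ∈ LR n := by
  have := FM_mem (n := n) (Pi.single s 1) (fun k => by
    rw [Pi.single_apply]; split_ifs <;> simp)
  convert this using 1
  funext x
  rw [FM_single, zpow_one]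

theorem mutO_mem {n : ℕ} (A : Matrix (Fin n ⊕ Fin n) (Fin n) ℤ) (i : Fin n) (s : Fin n ⊕ Fin n) :
    (fun x : Om n => (mutO A i x).1 s) ∈ LR n := by
  by_cases h : s = Sum.inl i
  · subst h
    simp only [mutO_val, Function.update_self]
    exact pf_mem A i
  · simp only [mutO_val, Function.update_of_ne h]
    exact coord_mem s

theorem main_aux {n : ℕ} (m : ℕ) : ∀ (L : List (Fin n)), L.length = m →
    ∀ A : Matrix (Fin n ⊕ Fin n) (Fin n) ℤ, Good A → ∀ r : Fin n,
    (fun x => (clus L A x).1 (Sum.inl r)) ∈ LR n := by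
  induction m using Nat.strong_induction_on with
  | _ m ih =>
  intro L hL A hA r
  rcases L with _ | ⟨i, _ | ⟨j, L⟩⟩
  · exact coord_mem _
  · exact mutO_mem A i _
  simp only [List.length_cons] at hL
  by_cases hij : i = j
  · subst hij
    have e : ∀ x, clus (i :: i :: L) A x = clus L A x := fun x => by
      simp only [clus]; rw [mm_mm, mutO_mutO hA]
    simp only [e]
    exact ih L.length (by omega) L rfl A hA r
  obtain ⟨hu, hv, hNu, hNv⟩ := core_all hA hij
  have hji : (Sum.inl j : Fin n ⊕ Fin n) ≠ Sum.inl i := by simpa using Ne.symm hij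
  set z : Om n → ℝ := fun x => (clus (i :: j :: L) A x).1 (Sum.inl r) with hz
  -- first neighbour
  obtain ⟨d1, h1⟩ := LR_strip (mutO A i) (mutO_mem A i) {i} (fun k hk x => by
      rw [mutO_val, Function.update_of_ne]; simpa using hk)
    _ (ih (L.length + 1) (by omega) (j :: L) rfl (matMutate Sum.inl A i) (hA.mm i) r)
  have h1' : z * pf A i ^ d1 i ∈ LR n := by
    convert h1 using 1
    funext x
    simp only [Finset.prod_singleton, mutO_val, Function.update_self]
    rfl
  -- third seed
  set A1 := matMutate Sum.inl A i with hA1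
  set A2 := matMutate Sum.inl A1 j with hA2
  have hG2 : Good A2 := (hA.mm i).mm j
  let Φ : Om n → Om n := fun x => mutO A2 i (mutO A1 j (mutO A i x))
  have hΦi : ∀ x, (Φ x).1 (Sum.inl i) = vf A i j x := fun x => by
    simp only [Φ, mutO_val A2, Function.update_self]; rfl
  have hΦj : ∀ x, (Φ x).1 (Sum.inl j) = uf A i j x := fun x => by
    simp only [Φ]
    rw [mutO_val A2, Function.update_of_ne hji, mutO_val A1, Function.update_self]; rfl
  have hΦo : ∀ s, s ≠ Sum.inl i → s ≠ Sum.inl j → ∀ x, (Φ x).1 s = x.1 s := fun s h1 h2 x => by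
    simp only [Φ]
    rw [mutO_val A2, Function.update_of_ne h1, mutO_val A1, Function.update_of_ne h2, mutO_val,
      Function.update_of_ne h1]
  obtain ⟨d3, h3⟩ := LR_strip Φ (fun s => by
      by_cases h1 : s = Sum.inl i
      · subst h1; simp only [hΦi]; exact hv
      by_cases h2 : s = Sum.inl j
      · subst h2; simp only [hΦj]; exact hu
      simp only [hΦo s h1 h2]; exact coord_mem s) {i, j} (fun k hk x => by
      simp only [Finset.mem_insert, Finset.mem_singleton, not_or] at hk
      exact hΦo _ (by simpa using hk.1) (by simpa using hk.2) x)
    _ (ih (L.length + 1) (by omega) (i :: L) rfl (matMutate Sum.inl A2 i) (hG2.mm i) r)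
  have h3' : z * (vf A i j ^ d3 i * uf A i j ^ d3 j) ∈ LR n := by
    convert h3 using 1
    funext x
    rw [Finset.prod_pair hij, hΦi, hΦj]
    have : clus (i :: L) (matMutate Sum.inl A2 i) (Φ x) = clus (i :: j :: L) A x := by
      simp only [clus, Φ]; rw [mm_mm, mutO_mutO hG2]
    rw [this]
    rfl
  exact NZ_final (fun x => (pf_pos A i x).ne')
    (NZ_mul ((LR n).pow_mem hv _) (NZ_pow hv hNv _) (NZ_pow hu hNu _))
    ((LR n).mul_mem ((LR n).pow_mem hv _) ((LR n).pow_mem hu _)) (pf_mem A i) _ h1' h3'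

theorem map_gmut {K K' : Type*} [Field K] [Field K'] (φ : K →+* K') {n : ℕ}
    (x : Fin n ⊕ Fin n → K) (A : Matrix (Fin n ⊕ Fin n) (Fin n) ℤ) (k : Fin n) (s) :
    φ (gmut x A k s) = gmut (fun s => φ (x s)) A k s := by
  by_cases h : s = Sum.inl k
  · subst h
    simp [gmut, fm, map_prod, map_zpow₀]
  · simp [gmut, h]

theorem fold_clus {n : ℕ} (φ : CField n →+* ℝ) (L : List (Fin n)) :
    ∀ (x : Fin n ⊕ Fin n → CField n) (A : Matrix (Fin n ⊕ Fin n) (Fin n) ℤ) (y : Om n),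
      (∀ s, φ (x s) = y.1 s) → ∀ s, φ ((L.foldl mutatePair (x, A)).1 s) = (clus L A y).1 s := by
  induction L with
  | nil => intro x A y h s; exact h s
  | cons k L ih =>
    intro x A y h s
    refine ih _ _ (mutO A k y) (fun t => ?_) s
    change φ (seedMutX x A k t) = gmut y.1 A k t
    rw [seedMutX_eq, map_gmut]
    congr 1
    funext t
    exact h t

/-- Laurent phenomenon: for a skew-symmetrizable `B`, every cluster variable
`z` of `A(B)` satisfies `z = f(x_1,…,x_n,y_1,…,y_n) / (x_1^{d_1} ⋯ x_n^{d_n})` for some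
polynomial `f` with integer coefficients and some `d_1, …, d_n ∈ ℤ_{≥0}`; i.e. `z` lies in
`ℤ[x_1^{±1},…,x_n^{±1},y_1,…,y_n]`. -/
theorem laurent_phenomenon {n : ℕ} (B : Matrix (Fin n) (Fin n) ℤ)
    (hskew : ∃ d : Fin n → ℤ, (∀ i, 0 < d i) ∧ ∀ i j, B i j * d j = -B j i * d i)
    (z : CField n) (hz : IsClusterVariable B z) :
    ∃ (f : MvPolynomial (Fin n ⊕ Fin n) ℤ) (d : Fin n → ℕ),
      z * ∏ i : Fin n, (initX n (Sum.inl i)) ^ (d i)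
        = MvPolynomial.aeval (initX n) f := by
  obtain ⟨L, r, rfl⟩ := hz
  obtain ⟨φ, hφ⟩ := exists_embed n
  let y : Om n := ⟨fun s => φ (initX n s), hφ⟩
  obtain ⟨f, d, h⟩ := main_aux L.length L rfl (principalExt B) (good_principal B hskew) r
  refine ⟨f, d, φ.injective ?_⟩
  have h0 := h y
  have hfe : ∀ f : MvPolynomial (Fin n ⊕ Fin n) ℤ,
      φ (MvPolynomial.aeval (initX n) f) = MvPolynomial.aeval y.1 f := by
    intro f
    induction f using MvPolynomial.induction_on with
    | C a => simp
    | add p q hp hq => simp only [map_add, hp, hq]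
    | mul_X p k hp => simp only [map_mul, hp, MvPolynomial.aeval_X]; rfl
  rw [hfe, ← h0, map_mul, map_prod, fold_clus φ L _ _ y (fun s => rfl)]
  simp only [map_pow]
  rfl
end
end

section
/- Let B be the 2×2 skew-symmetrizable integer matrix with entries b_{11}=0, b_{12}=-1, b_{21}=4, b_{22}=0. For each cluster variable z of the cluster algebra with principal coefficients A(B), let g(z) ∈ ℤ^2 be the unique vector such that z can be written as a finite ℤ-linear combination of monomials x_1^{a_1}x_2^{a_2}y_1^{c_1}y_2^{c_2} with a ∈ ℤ^2, c ∈ (ℤ_{≥0})^2 and a - Bc = g(z) (such a vector exists and is unique). For each cluster (z_1, z_2) of A(B), its g-vector cone is C({g(z_1), g(z_2)}) = {a_1 g(z_1) + a_2 g(z_2) : a_1, a_2 ∈ ℝ_{≥0}} ⊆ ℝ^2. Then the closure in ℝ^2 of the union of the g-vector cones over all clusters of A(B) equals ℝ^2. -/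
noncomputable section

/-- The skew-symmetrizable matrix `B = [[0, -1], [4, 0]]`. -/
def B10 : Matrix (Fin 2) (Fin 2) ℤ := !![0, -1; 4, 0]

/-- The cluster of `A(B)` obtained from the initial seed by the sequence of
mutations recorded in the list `L`. -/
def clusterOf (L : List (Fin 2)) : Fin 2 → CField 2 :=
  fun i => (L.foldl mutatePair (initX 2, principalExt B10)).1 (Sum.inl i)

/-- `g` is a g-vector of `z`: `z` is a finite `ℤ`-linear combination of monomials
`x_1^{a_1} x_2^{a_2} y_1^{c_1} y_2^{c_2}` with `a ∈ ℤ²`, `c ∈ (ℤ_{≥0})²`, and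
`a - B c = g` for every monomial occurring. -/
def IsGVec (z : CField 2) (g : Fin 2 → ℤ) : Prop :=
  ∃ f : ((Fin 2 → ℤ) × (Fin 2 → ℕ)) →₀ ℤ,
    z = f.sum (fun p m =>
        (m : CField 2) * (∏ i : Fin 2, (initX 2 (Sum.inl i)) ^ (p.1 i)) *
          ∏ i : Fin 2, (initX 2 (Sum.inr i)) ^ (p.2 i)) ∧
    ∀ p : (Fin 2 → ℤ) × (Fin 2 → ℕ), f p ≠ 0 →
      ∀ i, p.1 i - ∑ j, B10 i j * (p.2 j : ℤ) = g i

/-! ### Graded pieces -/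

abbrev cx1 : CField 2 := initX 2 (Sum.inl 0)
abbrev cx2 : CField 2 := initX 2 (Sum.inl 1)
abbrev cy1 : CField 2 := initX 2 (Sum.inr 0)
abbrev cy2 : CField 2 := initX 2 (Sum.inr 1)

def lmon (p : (Fin 2 → ℤ) × (Fin 2 → ℕ)) : CField 2 :=
  (∏ i : Fin 2, (initX 2 (Sum.inl i)) ^ (p.1 i)) * ∏ i : Fin 2, (initX 2 (Sum.inr i)) ^ (p.2 i)

lemma initX_ne (i) : initX 2 i ≠ 0 := by
  unfold initX
  intro h
  rw [map_eq_zero_iff _ (IsFractionRing.injective _ _)] at h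
  exact MvPolynomial.X_ne_zero i h

def HG (a b : ℤ) : AddSubgroup (CField 2) :=
  AddSubgroup.closure {z | ∃ p : (Fin 2 → ℤ) × (Fin 2 → ℕ),
    p.1 0 + p.2 1 = a ∧ p.1 1 - 4 * p.2 0 = b ∧ z = lmon p}

lemma HG_isGVec {z : CField 2} {a b : ℤ} (h : z ∈ HG a b) : IsGVec z ![a, b] := by
  unfold HG at h
  induction h using AddSubgroup.closure_induction with
  | mem z hz =>
    obtain ⟨p, h1, h2, rfl⟩ := hz
    refine ⟨Finsupp.single p 1, ?_, ?_⟩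
    · rw [Finsupp.sum_single_index]
      · simp [lmon]
      · simp
    · intro q hq
      have : q = p := by
        by_contra hne
        exact hq (by simp [Finsupp.single_apply, Ne.symm hne])
      subst this
      intro i
      fin_cases i
      · simp [B10, Fin.sum_univ_two]; linarith
      · simp [B10, Fin.sum_univ_two]; linarith
  | zero => exact ⟨0, by simp, by simp⟩
  | add x y _ _ hx hy =>
    obtain ⟨f, rfl, hf⟩ := hx
    obtain ⟨f', rfl, hf'⟩ := hy
    refine ⟨f + f', ?_, ?_⟩
    · rw [Finsupp.sum_add_index']
      · simp
      · intros; push_cast; ring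
    · intro p hp
      by_cases h : f p = 0
      · exact hf' p (by intro h'; exact hp (by simp [h, h']))
      · exact hf p h
  | neg x _ hx =>
    obtain ⟨f, rfl, hf⟩ := hx
    refine ⟨-f, ?_, ?_⟩
    · rw [Finsupp.sum_neg_index (by simp), Finsupp.sum, Finsupp.sum, ← Finset.sum_neg_distrib]
      refine Finset.sum_congr rfl fun p _ => ?_
      push_cast; ring
    · intro p hp
      exact hf p (by intro h'; exact hp (by simp [h']))

lemma lmon_mul (p q) : lmon p * lmon q = lmon (p + q) := by
  have h := initX_ne
  simp only [lmon, Fin.prod_univ_two, Prod.fst_add, Prod.snd_add, Pi.add_apply,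
    zpow_add₀ (h _), pow_add]
  ring

lemma HG_mul {z w : CField 2} {a b c d : ℤ} (hz : z ∈ HG a b) (hw : w ∈ HG c d) :
    z * w ∈ HG (a + c) (b + d) := by
  unfold HG at hz
  induction hz using AddSubgroup.closure_induction with
  | zero => rw [zero_mul]; exact zero_mem _
  | add x y _ _ hx hy => rw [add_mul]; exact add_mem hx hy
  | neg x _ hx => rw [neg_mul]; exact neg_mem hx
  | mem z hz =>
    obtain ⟨p, h1, h2, rfl⟩ := hz
    unfold HG at hw
    induction hw using AddSubgroup.closure_induction with
    | zero => rw [mul_zero]; exact zero_mem _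
    | add x y _ _ hx hy => rw [mul_add]; exact add_mem hx hy
    | neg x _ hx => rw [mul_neg]; exact neg_mem hx
    | mem w hw =>
      obtain ⟨q, h3, h4, rfl⟩ := hw
      refine AddSubgroup.subset_closure ⟨p + q, ?_, ?_, lmon_mul p q⟩
      · simp; linarith
      · simp; linarith

lemma HG_mon (p : (Fin 2 → ℤ) × (Fin 2 → ℕ)) : lmon p ∈ HG (p.1 0 + p.2 1) (p.1 1 - 4 * p.2 0) :=
  AddSubgroup.subset_closure ⟨p, rfl, rfl, rfl⟩

lemma HG_cast {z : CField 2} {a b c d : ℤ} (hz : z ∈ HG a b) (h1 : a = c) (h2 : b = d) :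
    z ∈ HG c d := by subst h1 h2; exact hz

lemma HG_one : (1 : CField 2) ∈ HG 0 0 := by
  simpa [lmon] using HG_mon (![0, 0], ![0, 0])

lemma HG_pow {z : CField 2} {a b : ℤ} (hz : z ∈ HG a b) (n : ℕ) : z ^ n ∈ HG (n * a) (n * b) := by
  induction n with
  | zero => simpa using HG_one
  | succ n ih =>
    rw [pow_succ]
    exact HG_cast (HG_mul ih hz) (by push_cast; ring) (by push_cast; ring)

lemma HG_x1 : cx1 ∈ HG 1 0 := by simpa [lmon] using HG_mon (![1, 0], ![0, 0])
lemma HG_x2 : cx2 ∈ HG 0 1 := by simpa [lmon] using HG_mon (![0, 1], ![0, 0])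
lemma HG_x1i : cx1⁻¹ ∈ HG (-1) 0 := by simpa [lmon] using HG_mon (![-1, 0], ![0, 0])
lemma HG_x2i : cx2⁻¹ ∈ HG 0 (-1) := by simpa [lmon] using HG_mon (![0, -1], ![0, 0])
lemma HG_y1 : cy1 ∈ HG 0 (-4) := by simpa [lmon] using HG_mon (![0, 0], ![1, 0])
lemma HG_y2 : cy2 ∈ HG 1 0 := by simpa [lmon] using HG_mon (![0, 0], ![0, 1])

/-! ### Uniqueness -/

lemma lmon_indep (f : ((Fin 2 → ℤ) × (Fin 2 → ℕ)) →₀ ℤ)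
    (h : f.sum (fun p m => (m : CField 2) * lmon p) = 0) : f = 0 := by
  classical
  by_contra hf
  obtain ⟨N, hN⟩ : ∃ N : ℕ, ∀ p ∈ f.support, ∀ i, 0 ≤ p.1 i + N := by
    refine ⟨∑ p ∈ f.support, ∑ i, (p.1 i).natAbs, fun p hp i => ?_⟩
    have h1 : (p.1 i).natAbs ≤ ∑ i, (p.1 i).natAbs :=
      Finset.single_le_sum (f := fun i => (p.1 i).natAbs) (fun _ _ => Nat.zero_le _)
        (Finset.mem_univ i)
    have h2 : ∑ i, (p.1 i).natAbs ≤ ∑ p ∈ f.support, ∑ i, (p.1 i).natAbs :=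
      Finset.single_le_sum (f := fun p : (Fin 2 → ℤ) × (Fin 2 → ℕ) => ∑ i, (p.1 i).natAbs)
        (fun _ _ => Nat.zero_le _) hp
    omega
  let e : ((Fin 2 → ℤ) × (Fin 2 → ℕ)) → (Fin 2 ⊕ Fin 2 →₀ ℕ) := fun p =>
    Finsupp.equivFunOnFinite.symm (Sum.elim (fun i => (p.1 i + N).toNat) p.2)
  have key : ∀ p ∈ f.support, lmon p * (cx1 ^ N * cx2 ^ N) =
      algebraMap (MvPolynomial (Fin 2 ⊕ Fin 2) ℚ) (CField 2) (MvPolynomial.monomial (e p) 1) := by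
    intro p hp
    rw [MvPolynomial.monomial_eq, Finsupp.prod_fintype _ _ (by simp)]
    have hx := initX_ne
    simp only [map_one, one_mul, map_mul, map_prod, map_pow, Fintype.prod_sum_type, lmon,
      Fin.prod_univ_two]
    have h0 : ∀ i, initX 2 (Sum.inl i) ^ (p.1 i) * initX 2 (Sum.inl i) ^ N =
        initX 2 (Sum.inl i) ^ (p.1 i + N).toNat := by
      intro i
      rw [← zpow_natCast, ← zpow_natCast, Int.toNat_of_nonneg (hN p hp i), ← zpow_add₀ (hx _)]
    have e0 := h0 0
    have e1 := h0 1
    change _ = initX 2 (Sum.inl 0) ^ (p.1 0 + N).toNat * initX 2 (Sum.inl 1) ^ (p.1 1 + N).toNat *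
      (initX 2 (Sum.inr 0) ^ (p.2 0) * initX 2 (Sum.inr 1) ^ (p.2 1))
    rw [← e0, ← e1]
    ring
  have h3 : algebraMap (MvPolynomial (Fin 2 ⊕ Fin 2) ℚ) (CField 2)
      (∑ p ∈ f.support, MvPolynomial.monomial (e p) (f p : ℚ)) = 0 := by
    have : f.sum (fun p m => (m : CField 2) * lmon p) * (cx1 ^ N * cx2 ^ N) = 0 := by
      rw [h, zero_mul]
    rw [← this, Finsupp.sum, Finset.sum_mul, map_sum]
    refine Finset.sum_congr rfl fun p hp => ?_
    rw [mul_assoc, key p hp]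
    have : MvPolynomial.monomial (e p) (f p : ℚ) =
      ((f p : ℤ) : MvPolynomial (Fin 2 ⊕ Fin 2) ℚ) * MvPolynomial.monomial (e p) 1 := by
      rw [← zsmul_eq_mul, ← map_zsmul]; simp
    rw [this, map_mul, map_intCast]
  rw [map_eq_zero_iff _ (IsFractionRing.injective _ _)] at h3
  obtain ⟨p0, hp0⟩ := Finsupp.support_nonempty_iff.mpr hf
  have h4 := congrArg (MvPolynomial.coeff (e p0)) h3
  rw [MvPolynomial.coeff_sum, Finset.sum_eq_single p0] at h4
  · simp at h4
    exact (Finsupp.mem_support_iff.mp hp0) h4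
  · intro q hq hne
    rw [MvPolynomial.coeff_monomial, if_neg]
    intro heq
    apply hne
    have h5 : ∀ i, (q.1 i + N).toNat = (p0.1 i + N).toNat := fun i =>
      DFunLike.congr_fun heq (Sum.inl i)
    have h6 : ∀ i, q.2 i = p0.2 i := fun i => DFunLike.congr_fun heq (Sum.inr i)
    refine Prod.ext (funext fun i => ?_) (funext h6)
    have := h5 i
    have := hN q hq i
    have := hN p0 hp0 i
    omega
  · intro h; exact absurd hp0 h

lemma gvec_unique {z : CField 2} (hz : z ≠ 0) {g g' : Fin 2 → ℤ} (h : IsGVec z g)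
    (h' : IsGVec z g') : g = g' := by
  obtain ⟨f, hf, hg⟩ := h
  obtain ⟨f', hf', hg'⟩ := h'
  have hff : f - f' = 0 := by
    apply lmon_indep
    rw [Finsupp.sum_sub_index]
    · simp only [mul_assoc] at hf hf'
      simp only [lmon]
      rw [← hf, ← hf', sub_self]
    · intros; push_cast; ring
  have hff : f = f' := sub_eq_zero.mp hff
  subst hff
  have : f ≠ 0 := by
    rintro rfl
    exact hz (by simpa using hf)
  obtain ⟨p, hp⟩ := Finsupp.support_nonempty_iff.mpr this
  have hp := Finsupp.mem_support_iff.mp hp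
  funext i
  rw [← hg p hp i, ← hg' p hp i]

/-! ### Positivity -/

def CPos (z : CField 2) : Prop :=
  ∃ P Q : MvPolynomial (Fin 2 ⊕ Fin 2) ℚ, 0 < MvPolynomial.eval 1 P ∧ 0 < MvPolynomial.eval 1 Q ∧
    z = algebraMap _ (CField 2) P / algebraMap _ (CField 2) Q

lemma am_ne {P : MvPolynomial (Fin 2 ⊕ Fin 2) ℚ} (h : 0 < MvPolynomial.eval 1 P) :
    algebraMap _ (CField 2) P ≠ 0 := by
  intro h'
  rw [map_eq_zero_iff _ (IsFractionRing.injective _ _)] at h'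
  subst h'
  simp at h

lemma CPos.ne {z} (h : CPos z) : z ≠ 0 := by
  obtain ⟨P, Q, hP, hQ, rfl⟩ := h
  exact div_ne_zero (am_ne hP) (am_ne hQ)

lemma CPos.mul {z w} (h : CPos z) (h' : CPos w) : CPos (z * w) := by
  obtain ⟨P, Q, hP, hQ, rfl⟩ := h
  obtain ⟨P', Q', hP', hQ', rfl⟩ := h'
  refine ⟨P * P', Q * Q', by simpa using mul_pos hP hP', by simpa using mul_pos hQ hQ', ?_⟩
  simp only [map_mul]
  rw [div_mul_div_comm]

lemma CPos.add {z w} (h : CPos z) (h' : CPos w) : CPos (z + w) := by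
  obtain ⟨P, Q, hP, hQ, rfl⟩ := h
  obtain ⟨P', Q', hP', hQ', rfl⟩ := h'
  refine ⟨P * Q' + Q * P', Q * Q', ?_, by simpa using mul_pos hQ hQ', ?_⟩
  · simp only [map_add, map_mul]; positivity
  · simp only [map_mul, map_add]
    rw [div_add_div _ _ (am_ne hQ) (am_ne hQ')]

lemma CPos.inv {z} (h : CPos z) : CPos z⁻¹ := by
  obtain ⟨P, Q, hP, hQ, rfl⟩ := h
  exact ⟨Q, P, hQ, hP, by rw [inv_div]⟩

lemma CPos.one : CPos 1 := ⟨1, 1, by simp, by simp, by simp⟩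

lemma CPos.pow {z} (h : CPos z) (n : ℕ) : CPos (z ^ n) := by
  induction n with
  | zero => simpa using CPos.one
  | succ n ih => rw [pow_succ]; exact ih.mul h

lemma CPos.of_mul {z w} (h : CPos (z * w)) (h' : CPos w) : CPos z := by
  have := h.mul h'.inv
  rwa [mul_assoc, mul_inv_cancel₀ h'.ne, mul_one] at this

lemma CPos.init (i) : CPos (initX 2 i) := ⟨MvPolynomial.X i, 1, by simp, by simp, by simp [initX]⟩

/-! ### Sequences -/

def vseq (K w v0 v1 : CField 2) : ℕ → CField 2
  | 0 => v0
  | 1 => v1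
  | n + 2 => K * vseq K w v0 v1 (n + 1) - w * vseq K w v0 v1 n

lemma vseq_rel {K w v0 v1 q : CField 2} (h : (K * v1 - w * v0) * v0 = v1 ^ 2 + q * K) (n : ℕ) :
    vseq K w v0 v1 (n + 2) * vseq K w v0 v1 n = vseq K w v0 v1 (n + 1) ^ 2 + w ^ n * q * K := by
  induction n with
  | zero => simpa [vseq] using h
  | succ n ih =>
    have e1 : vseq K w v0 v1 (n + 1 + 2) = K * vseq K w v0 v1 (n + 2) - w * vseq K w v0 v1 (n + 1) :=
      rfl
    have e2 : vseq K w v0 v1 (n + 2) = K * vseq K w v0 v1 (n + 1) - w * vseq K w v0 v1 n := rfl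
    rw [e1, show n + 1 + 1 = n + 2 from rfl]
    rw [pow_succ w n]
    linear_combination w * ih - vseq K w v0 v1 (n + 2) * e2

lemma rseq_rel {K w v0 v1 q : CField 2} (h : (K * v1 - w * v0) * v0 = v1 ^ 2 + q * K) (n : ℕ) :
    (vseq K w v0 v1 (n + 2) * vseq K w v0 v1 (n + 1) - w ^ (n + 1) * q) *
      (vseq K w v0 v1 (n + 1) * vseq K w v0 v1 n - w ^ n * q) =
      vseq K w v0 v1 (n + 1) ^ 4 + w ^ (2 * n + 1) * q ^ 2 := by
  have := vseq_rel h n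
  have e2 : vseq K w v0 v1 (n + 2) = K * vseq K w v0 v1 (n + 1) - w * vseq K w v0 v1 n := rfl
  rw [show w ^ (2 * n + 1) = w ^ n * w ^ n * w by ring, pow_succ]
  linear_combination vseq K w v0 v1 (n + 1) ^ 2 * this - w ^ n * q * vseq K w v0 v1 (n + 1) * e2

def cK : CField 2 := ((cx1 + cy2) ^ 2 * cx2⁻¹ ^ 2 + cy1 * cy2 ^ 2 * cx2 ^ 2) * cx1⁻¹
def cw : CField 2 := cy1 * cy2 ^ 2

/-- B side -/
def vB : ℕ → CField 2 := vseq cK cw cx2 ((cx1 + cy2) * cx2⁻¹)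
def rB (n : ℕ) : CField 2 := vB (n + 1) * vB n - cw ^ n * cy2
/-- A side -/
def uA : CField 2 := (cx2 ^ 4 * cy1 + 1) * cx1⁻¹
def vA : ℕ → CField 2 := vseq cK cw (cx2 * cy2⁻¹) ((uA * cy2 + 1) * cx2⁻¹)
def rA (n : ℕ) : CField 2 := vA (n + 1) * vA n - cw ^ n * cy2⁻¹

lemma vB_zero : vB 0 = cx2 := rfl
lemma vB_one : vB 1 = (cx1 + cy2) * cx2⁻¹ := rfl
lemma vA_zero : vA 0 = cx2 * cy2⁻¹ := rfl
lemma vA_one : vA 1 = (uA * cy2 + 1) * cx2⁻¹ := rfl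
lemma vA_rec (n) : vA (n + 2) = cK * vA (n + 1) - cw * vA n := rfl
lemma vB_rec (n) : vB (n + 2) = cK * vB (n + 1) - cw * vB n := rfl

lemma hx1 : cx1 ≠ 0 := initX_ne _
lemma hx2 : cx2 ≠ 0 := initX_ne _
lemma hy1 : cy1 ≠ 0 := initX_ne _
lemma hy2 : cy2 ≠ 0 := initX_ne _

lemma rB_zero : rB 0 = cx1 := by
  have := hx2
  rw [rB, vB_zero, vB_one]; field_simp; ring
lemma rA_zero : rA 0 = uA := by
  have := hx2; have := hy2
  rw [rA, vA_zero, vA_one]; field_simp; ring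

lemma rB_rel (n) : rB (n + 1) * rB n = vB (n + 1) ^ 4 + cy1 ^ (2 * n + 1) * cy2 ^ (4 * n + 4) := by
  have := hx1; have := hx2; have := hy2
  have h := rseq_rel (K := cK) (w := cw) (v0 := cx2) (v1 := (cx1 + cy2) * cx2⁻¹) (q := cy2)
    (by unfold cK cw; field_simp; ring) n
  unfold rB vB
  rw [h]; congr 1
  rw [cw, mul_pow, ← pow_mul, mul_assoc, ← pow_add]; ring

lemma vB_rel (n) : vB (n + 1) * vB n = rB n + cy1 ^ n * cy2 ^ (2 * n + 1) := by
  rw [rB, cw]; ring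

lemma rA_rel (n) : rA (n + 1) * rA n = vA (n + 1) ^ 4 + cy1 ^ (2 * n + 1) * cy2 ^ (4 * n) := by
  have := hx1; have := hx2; have := hy2
  have h := rseq_rel (K := cK) (w := cw) (v0 := cx2 * cy2⁻¹) (v1 := (uA * cy2 + 1) * cx2⁻¹)
    (q := cy2⁻¹) (by unfold cK cw uA; field_simp; ring) n
  unfold rA vA
  rw [h]; congr 1
  rw [cw, mul_pow]
  field_simp
  ring

lemma vA_rel (n) : vA (n + 2) * vA (n + 1) = rA (n + 1) + cy1 ^ (n + 1) * cy2 ^ (2 * n + 1) := by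
  have := hy2
  rw [rA, cw, mul_pow]; field_simp; ring

lemma vA_one_rel : vA 1 * cx2 = rA 0 * cy2 + 1 := by
  have := hx2
  rw [rA_zero, vA_one]; field_simp

lemma rA_zero_rel : rA 0 * cx1 = cx2 ^ 4 * cy1 + 1 := by
  have := hx1
  rw [rA_zero, uA]; field_simp

lemma posB (n) : CPos (vB n) ∧ CPos (rB n) := by
  have hy1 : CPos cy1 := CPos.init _
  have hy2 : CPos cy2 := CPos.init _
  induction n with
  | zero => rw [vB_zero, rB_zero]; exact ⟨CPos.init _, CPos.init _⟩
  | succ n ih =>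
    have hv : CPos (vB (n + 1)) := by
      refine CPos.of_mul (w := vB n) ?_ ih.1
      rw [vB_rel]; exact ih.2.add ((hy1.pow _).mul (hy2.pow _))
    refine ⟨hv, CPos.of_mul (w := rB n) ?_ ih.2⟩
    rw [rB_rel]; exact (hv.pow _).add ((hy1.pow _).mul (hy2.pow _))

lemma posA (n) : CPos (rA n) ∧ CPos (vA (n + 1)) := by
  have hy1 : CPos cy1 := CPos.init _
  have hy2 : CPos cy2 := CPos.init _
  have hx1 : CPos cx1 := CPos.init _
  have hx2 : CPos cx2 := CPos.init _
  induction n with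
  | zero =>
    have hr : CPos (rA 0) := by
      refine CPos.of_mul (w := cx1) ?_ hx1
      rw [rA_zero_rel]; exact ((hx2.pow _).mul hy1).add CPos.one
    refine ⟨hr, CPos.of_mul (w := cx2) ?_ hx2⟩
    rw [vA_one_rel]; exact (hr.mul hy2).add CPos.one
  | succ n ih =>
    have hr : CPos (rA (n + 1)) := by
      refine CPos.of_mul (w := rA n) ?_ ih.1
      rw [rA_rel]; exact (ih.2.pow _).add ((hy1.pow _).mul (hy2.pow _))
    refine ⟨hr, CPos.of_mul (w := vA (n + 1)) ?_ ih.2⟩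
    rw [vA_rel]; exact hr.add ((hy1.pow _).mul (hy2.pow _))

/-! ### degrees -/

lemma HG_K : cK ∈ HG 1 (-2) := by
  unfold cK
  refine HG_cast (HG_mul (a := 2) (b := -2) (add_mem ?_ ?_) HG_x1i) (by norm_num) (by norm_num)
  · exact HG_cast (HG_mul (HG_pow (add_mem HG_x1 HG_y2) 2) (HG_pow HG_x2i 2))
      (by norm_num) (by norm_num)
  · exact HG_cast (HG_mul (HG_mul HG_y1 (HG_pow HG_y2 2)) (HG_pow HG_x2 2))
      (by norm_num) (by norm_num)

lemma HG_w : cw ∈ HG 2 (-4) :=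
  HG_cast (HG_mul HG_y1 (HG_pow HG_y2 2)) (by norm_num) (by norm_num)

lemma HG_uA : uA ∈ HG (-1) 0 := by
  unfold uA
  refine HG_cast (HG_mul (add_mem ?_ HG_one) HG_x1i) (by norm_num) (by norm_num)
  exact HG_cast (HG_mul (HG_pow HG_x2 4) HG_y1) (by norm_num) (by norm_num)

lemma HG_vA1 : vA 1 ∈ HG 0 (-1) := by
  rw [vA_one]
  refine HG_cast (HG_mul (add_mem ?_ HG_one) HG_x2i) (by norm_num) (by norm_num)
  exact HG_cast (HG_mul HG_uA HG_y2) (by norm_num) (by norm_num)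

lemma HG_vA2 : vA 2 ∈ HG 1 (-3) := by
  have e : vA 2 = cK * vA 1 - cy1 * cy2 * cx2 := by
    have := hy2
    rw [vA_rec 0, vA_zero, cw]; field_simp
  rw [e]
  refine sub_mem ?_ ?_
  · exact HG_cast (HG_mul HG_K HG_vA1) (by norm_num) (by norm_num)
  · exact HG_cast (HG_mul (HG_mul HG_y1 HG_y2) HG_x2) (by norm_num) (by norm_num)

lemma HG_vA (n : ℕ) : vA (n + 1) ∈ HG n (-2 * n - 1) ∧ vA (n + 2) ∈ HG (n + 1) (-2 * n - 3) := by
  induction n with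
  | zero => exact ⟨HG_cast HG_vA1 (by norm_num) (by norm_num),
      HG_cast HG_vA2 (by norm_num) (by norm_num)⟩
  | succ n ih =>
    refine ⟨HG_cast ih.2 (by push_cast; ring) (by push_cast; ring), ?_⟩
    rw [show n + 1 + 2 = (n + 1) + 2 from rfl, vA_rec]
    refine sub_mem ?_ ?_
    · exact HG_cast (HG_mul HG_K ih.2) (by push_cast; ring) (by push_cast; ring)
    · exact HG_cast (HG_mul HG_w ih.1) (by push_cast; ring) (by push_cast; ring)

lemma HG_rA (n : ℕ) : rA n ∈ HG (2 * n - 1) (-4 * n) := by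
  rcases n with _ | n
  · rw [rA_zero]; exact HG_cast HG_uA (by norm_num) (by norm_num)
  · rw [eq_sub_of_add_eq (vA_rel n).symm]
    refine sub_mem ?_ ?_
    · exact HG_cast (HG_mul (HG_vA n).2 (HG_vA n).1) (by push_cast; ring) (by push_cast; ring)
    · exact HG_cast (HG_mul (HG_pow HG_y1 _) (HG_pow HG_y2 _))
        (by push_cast; ring) (by push_cast; ring)

lemma HG_vB (n : ℕ) : vB n ∈ HG n (1 - 2 * n) ∧ vB (n + 1) ∈ HG (n + 1) (-1 - 2 * n) := by
  induction n with
  | zero =>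
    refine ⟨HG_cast HG_x2 (by norm_num) (by norm_num), ?_⟩
    rw [vB_one]
    exact HG_cast (HG_mul (add_mem HG_x1 HG_y2) HG_x2i) (by norm_num) (by norm_num)
  | succ n ih =>
    refine ⟨HG_cast ih.2 (by push_cast; ring) (by push_cast; ring), ?_⟩
    rw [show n + 1 + 1 = n + 2 from rfl, vB_rec]
    refine sub_mem ?_ ?_
    · exact HG_cast (HG_mul HG_K ih.2) (by push_cast; ring) (by push_cast; ring)
    · exact HG_cast (HG_mul HG_w ih.1) (by push_cast; ring) (by push_cast; ring)

lemma HG_rB (n : ℕ) : rB n ∈ HG (2 * n + 1) (-4 * n) := by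
  rw [eq_sub_of_add_eq (vB_rel n).symm]
  refine sub_mem ?_ ?_
  · exact HG_cast (HG_mul (HG_vB n).2 (HG_vB n).1) (by push_cast; ring) (by push_cast; ring)
  · exact HG_cast (HG_mul (HG_pow HG_y1 _) (HG_pow HG_y2 _))
      (by push_cast; ring) (by push_cast; ring)

/-! ### Seeds -/

abbrev CSeed := (Fin 2 ⊕ Fin 2 → CField 2) × Matrix (Fin 2 ⊕ Fin 2) (Fin 2) ℤ

def mkX (u v : CField 2) : Fin 2 ⊕ Fin 2 → CField 2 := Sum.elim ![u, v] ![cy1, cy2]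
def mkM (e a b c d : ℤ) : Matrix (Fin 2 ⊕ Fin 2) (Fin 2) ℤ :=
  Sum.elim ![![0, -e], ![4 * e, 0]] ![![a, b], ![c, d]]
def mkS (e a b c d : ℤ) (u v : CField 2) : CSeed := (mkX u v, mkM e a b c d)

lemma mkS_init : ((initX 2, principalExt B10) : CSeed) = mkS 1 1 0 0 1 cx1 cx2 := by
  refine Prod.ext ?_ ?_
  · funext i
    rcases i with i | i <;> fin_cases i <;> rfl
  · funext i j
    rcases i with i | i <;> fin_cases i <;> fin_cases j <;> rfl

lemma mut1p {a b c d : ℤ} {u v u' : CField 2} {b' d' : ℤ} (hu : u ≠ 0)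
    (h : u' * u = v ^ 4 * (cy1 ^ a.toNat * cy2 ^ c.toNat) + cy1 ^ (-a).toNat * cy2 ^ (-c).toNat)
    (hb : b' = b - max (-a) 0) (hd : d' = d - max (-c) 0) :
    mutatePair (mkS 1 a b c d u v) 0 = mkS (-1) (-a) b' (-c) d' u' v := by
  refine Prod.ext ?_ ?_
  · funext i
    rcases i with i | i <;> fin_cases i
    · simp [mutatePair, mkS, mkX, mkM, seedMutX, Fin.prod_univ_two]
      rw [← h]; field_simp
    all_goals simp [mutatePair, mkS, mkX, mkM, seedMutX]
  · subst hb hd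
    funext i j
    rcases i with i | i <;> fin_cases i <;> fin_cases j <;>
      simp [mutatePair, mkS, mkX, mkM, matMutate] <;> ring

lemma mut2p {a b c d : ℤ} {u v v' : CField 2} {a' c' : ℤ} (hv : v ≠ 0)
    (h : v' * v = cy1 ^ b.toNat * cy2 ^ d.toNat + u * (cy1 ^ (-b).toNat * cy2 ^ (-d).toNat))
    (ha : a' = a + 4 * max b 0) (hc : c' = c + 4 * max d 0) :
    mutatePair (mkS 1 a b c d u v) 1 = mkS (-1) a' (-b) c' (-d) u v' := by
  refine Prod.ext ?_ ?_
  · funext i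
    rcases i with i | i <;> fin_cases i
    · simp [mutatePair, mkS, mkX, mkM, seedMutX]
    · simp [mutatePair, mkS, mkX, mkM, seedMutX, Fin.prod_univ_two]
      rw [← h]; field_simp
    all_goals simp [mutatePair, mkS, mkX, mkM, seedMutX]
  · subst ha hc
    funext i j
    rcases i with i | i <;> fin_cases i <;> fin_cases j <;>
      simp [mutatePair, mkS, mkX, mkM, matMutate] <;> omega

lemma mut1m {a b c d : ℤ} {u v u' : CField 2} {b' d' : ℤ} (hu : u ≠ 0)
    (h : u' * u = cy1 ^ a.toNat * cy2 ^ c.toNat + v ^ 4 * (cy1 ^ (-a).toNat * cy2 ^ (-c).toNat))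
    (hb : b' = b + max a 0) (hd : d' = d + max c 0) :
    mutatePair (mkS (-1) a b c d u v) 0 = mkS 1 (-a) b' (-c) d' u' v := by
  refine Prod.ext ?_ ?_
  · funext i
    rcases i with i | i <;> fin_cases i
    · simp [mutatePair, mkS, mkX, mkM, seedMutX, Fin.prod_univ_two]
      rw [← h]; field_simp
    all_goals simp [mutatePair, mkS, mkX, mkM, seedMutX]
  · subst hb hd
    funext i j
    rcases i with i | i <;> fin_cases i <;> fin_cases j <;>
      simp [mutatePair, mkS, mkX, mkM, matMutate] <;> omega

lemma mut2m {a b c d : ℤ} {u v v' : CField 2} {a' c' : ℤ} (hv : v ≠ 0)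
    (h : v' * v = u * (cy1 ^ b.toNat * cy2 ^ d.toNat) + cy1 ^ (-b).toNat * cy2 ^ (-d).toNat)
    (ha : a' = a - 4 * max (-b) 0) (hc : c' = c - 4 * max (-d) 0) :
    mutatePair (mkS (-1) a b c d u v) 1 = mkS 1 a' (-b) c' (-d) u v' := by
  refine Prod.ext ?_ ?_
  · funext i
    rcases i with i | i <;> fin_cases i
    · simp [mutatePair, mkS, mkX, mkM, seedMutX]
    · simp [mutatePair, mkS, mkX, mkM, seedMutX, Fin.prod_univ_two]
      rw [← h]; field_simp
    all_goals simp [mutatePair, mkS, mkX, mkM, seedMutX]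
  · subst ha hc
    funext i j
    rcases i with i | i <;> fin_cases i <;> fin_cases j <;>
      simp [mutatePair, mkS, mkX, mkM, matMutate] <;> omega

def SAe (n : ℕ) : CSeed := mkS 1 (-(2 * n + 1)) n (-(4 * n)) (2 * n - 1) (rA n) (vA (n + 1))
def SAo (n : ℕ) : CSeed :=
  mkS (-1) (2 * n + 1) (-(n + 1)) (4 * n) (-(2 * n + 1)) (rA (n + 1)) (vA (n + 1))
def SBe (n : ℕ) : CSeed := mkS 1 (-(2 * n - 1)) n (-(4 * n)) (2 * n + 1) (rB n) (vB n)
def SBo (n : ℕ) : CSeed :=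
  mkS (-1) (2 * n + 1) (-n) (4 * n + 4) (-(2 * n + 1)) (rB n) (vB (n + 1))
def SC : CSeed := mkS (-1) (-1) 0 0 1 (rA 0) cx2

lemma mkS_congr {e a b c d a' b' c' d' : ℤ} {u v : CField 2} (h1 : a = a') (h2 : b = b')
    (h3 : c = c') (h4 : d = d') : mkS e a b c d u v = mkS e a' b' c' d' u v := by
  subst h1 h2 h3 h4; rfl

lemma tn {z : ℤ} {k : ℕ} (h : z = k) : z.toNat = k := by omega
lemma tz {z : ℤ} (h : z ≤ 0) : z.toNat = 0 := by omega

lemma SB0 : SBe 0 = mkS 1 1 0 0 1 cx1 cx2 := by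
  unfold SBe; rw [rB_zero, vB_zero]; apply mkS_congr <;> norm_num

lemma SBe_1 (n) : mutatePair (SBe n) 1 = SBo n := by
  unfold SBe SBo
  rw [mut2p (a' := 2 * n + 1) (c' := 4 * n + 4) (v' := vB (n + 1)) (posB n).1.ne]
  · rw [vB_rel, tn (k := n) (by omega), tn (k := 2 * n + 1) (by omega), tz (by omega),
      tz (by omega)]; ring
  · omega
  · omega

lemma SBo_1 (n) : mutatePair (SBo n) 1 = SBe n := by
  unfold SBe SBo
  rw [mut2m (a' := -(2 * n - 1)) (c' := -(4 * n)) (v' := vB n) (posB (n + 1)).1.ne]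
  · apply mkS_congr <;> ring
  · rw [mul_comm, vB_rel, tz (by omega), tz (by omega), tn (k := n) (by omega),
      tn (k := 2 * n + 1) (by omega)]; ring
  · omega
  · omega

lemma SBo_0 (n) : mutatePair (SBo n) 0 = SBe (n + 1) := by
  unfold SBe SBo
  rw [mut1m (b' := n + 1) (d' := 2 * n + 3) (u' := rB (n + 1)) (posB n).2.ne]
  · apply mkS_congr <;> push_cast <;> ring
  · rw [rB_rel, tn (k := 2 * n + 1) (by omega), tn (k := 4 * n + 4) (by omega), tz (by omega),
      tz (by omega)]; ring
  · omega
  · omega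

lemma SBe_0 (n) : mutatePair (SBe (n + 1)) 0 = SBo n := by
  unfold SBe SBo
  rw [mut1p (b' := -n) (d' := -(2 * n + 1)) (u' := rB n) (posB (n + 1)).2.ne]
  · apply mkS_congr <;> push_cast <;> ring
  · rw [mul_comm, rB_rel, tz (by omega), tz (by omega), tn (k := 2 * n + 1) (by omega),
      tn (k := 4 * n + 4) (by omega)]; ring
  · omega
  · omega

lemma SB0_0 : mutatePair (SBe 0) 0 = SC := by
  rw [SB0]; unfold SC
  rw [mut1p (b' := 0) (d' := 1) (u' := rA 0) hx1]
  · apply mkS_congr <;> norm_num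
  · rw [rA_zero_rel]; simp
  · omega
  · omega

lemma SC_0 : mutatePair SC 0 = SBe 0 := by
  rw [SB0]; unfold SC
  rw [mut1m (b' := 0) (d' := 1) (u' := cx1) (posA 0).1.ne]
  · apply mkS_congr <;> norm_num
  · rw [mul_comm, rA_zero_rel]; simp; ring
  · omega
  · omega

lemma SC_1 : mutatePair SC 1 = SAe 0 := by
  unfold SC SAe
  rw [mut2m (a' := -1) (c' := 0) (v' := vA 1) hx2]
  · apply mkS_congr <;> norm_num
  · rw [vA_one_rel]; simp
  · omega
  · omega

lemma SA0_1 : mutatePair (SAe 0) 1 = SC := by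
  unfold SC SAe
  rw [mut2p (a' := -1) (c' := 0) (v' := cx2) (posA 0).2.ne]
  · apply mkS_congr <;> norm_num
  · rw [mul_comm, vA_one_rel]; simp; ring
  · simp
  · simp

lemma SAe_0 (n) : mutatePair (SAe n) 0 = SAo n := by
  unfold SAe SAo
  rw [mut1p (b' := -(n + 1)) (d' := -(2 * n + 1)) (u' := rA (n + 1)) (posA n).1.ne]
  · apply mkS_congr <;> ring
  · rw [rA_rel, tz (by omega), tz (by omega), tn (k := 2 * n + 1) (by omega),
      tn (k := 4 * n) (by omega)]; ring
  · omega
  · omega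

lemma SAo_0 (n) : mutatePair (SAo n) 0 = SAe n := by
  unfold SAe SAo
  rw [mut1m (b' := n) (d' := 2 * n - 1) (u' := rA n) (posA (n + 1)).1.ne]
  · rw [mul_comm, rA_rel, tn (k := 2 * n + 1) (by omega), tn (k := 4 * n) (by omega),
      tz (by omega), tz (by omega)]; ring
  · omega
  · omega

lemma SAo_1 (n) : mutatePair (SAo n) 1 = SAe (n + 1) := by
  unfold SAe SAo
  rw [mut2m (a' := -(2 * n + 3)) (c' := -(4 * n + 4)) (v' := vA (n + 2)) (posA n).2.ne]
  · apply mkS_congr <;> push_cast <;> ring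
  · rw [vA_rel, tz (by omega), tz (by omega), tn (k := n + 1) (by omega),
      tn (k := 2 * n + 1) (by omega)]; ring
  · omega
  · omega

lemma SAe_1 (n) : mutatePair (SAe (n + 1)) 1 = SAo n := by
  unfold SAe SAo
  rw [mut2p (a' := 2 * n + 1) (c' := 4 * n) (v' := vA (n + 1)) (posA (n + 1)).2.ne]
  · apply mkS_congr <;> push_cast <;> ring
  · rw [mul_comm, vA_rel, tn (k := n + 1) (by omega), tn (k := 2 * n + 1) (by omega),
      tz (by omega), tz (by omega)]; ring
  · push_cast; omega
  · push_cast; omega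

def SeedOf (L : List (Fin 2)) : CSeed := L.foldl mutatePair (initX 2, principalExt B10)

lemma SeedOf_nil : SeedOf [] = SBe 0 := by rw [SB0, ← mkS_init]; rfl

lemma SeedOf_snoc (L k) : SeedOf (L ++ [k]) = mutatePair (SeedOf L) k := by simp [SeedOf]

def SGood (p : CSeed) : Prop :=
  p = SC ∨ (∃ n, p = SAe n) ∨ (∃ n, p = SAo n) ∨ (∃ n, p = SBe n) ∨ (∃ n, p = SBo n)

lemma SGood_mut {p} (h : SGood p) (k) : SGood (mutatePair p k) := by
  have hk : k = 0 ∨ k = 1 := by omega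
  unfold SGood
  rcases h with rfl | ⟨n, rfl⟩ | ⟨n, rfl⟩ | ⟨n, rfl⟩ | ⟨n, rfl⟩ <;> rcases hk with rfl | rfl
  · rw [SC_0]; simp
  · rw [SC_1]; simp
  · rw [SAe_0]; simp
  · rcases n with _ | n
    · rw [SA0_1]; simp
    · rw [SAe_1]; simp
  · rw [SAo_0]; simp
  · rw [SAo_1]; simp
  · rcases n with _ | n
    · rw [SB0_0]; simp
    · rw [SBe_0]; simp
  · rw [SBe_1]; simp
  · rw [SBo_0]; simp
  · rw [SBo_1]; simp

lemma SGood_all (L) : SGood (SeedOf L) := by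
  induction L using List.reverseRecOn with
  | nil => rw [SeedOf_nil]; exact Or.inr (Or.inr (Or.inr (Or.inl ⟨0, rfl⟩)))
  | append_singleton L k ih => rw [SeedOf_snoc]; exact SGood_mut ih k

lemma reach_step {p : CSeed} (h : ∃ L, SeedOf L = p) (k) : ∃ L, SeedOf L = mutatePair p k := by
  obtain ⟨L, rfl⟩ := h
  exact ⟨L ++ [k], SeedOf_snoc L k⟩

lemma reach_Be (n) : ∃ L, SeedOf L = SBe n := by
  induction n with
  | zero => exact ⟨[], SeedOf_nil⟩
  | succ n ih => rw [← SBo_0, ← SBe_1]; exact reach_step (reach_step ih _) _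
lemma reach_Bo (n) : ∃ L, SeedOf L = SBo n := by
  rw [← SBe_1]; exact reach_step (reach_Be n) _
lemma reach_C : ∃ L, SeedOf L = SC := by
  rw [← SB0_0]; exact reach_step (reach_Be 0) _
lemma reach_Ae (n) : ∃ L, SeedOf L = SAe n := by
  induction n with
  | zero => rw [← SC_1]; exact reach_step reach_C _
  | succ n ih => rw [← SAo_1, ← SAe_0]; exact reach_step (reach_step ih _) _
lemma reach_Ao (n) : ∃ L, SeedOf L = SAo n := by
  rw [← SAe_0]; exact reach_step (reach_Ae n) _

lemma clusterOf_eq {L} {e a b c d : ℤ} {u v : CField 2} (h : SeedOf L = mkS e a b c d u v) :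
    clusterOf L 0 = u ∧ clusterOf L 1 = v := by
  have : ∀ i, clusterOf L i = (SeedOf L).1 (Sum.inl i) := fun i => rfl
  rw [this, this, h]
  exact ⟨rfl, rfl⟩

lemma good_ex {z : CField 2} {a b : ℤ} (h : CPos z) (h' : z ∈ HG a b) :
    ∃! g : Fin 2 → ℤ, IsGVec z g :=
  ⟨_, HG_isGVec h', fun _ hg => gvec_unique h.ne hg (HG_isGVec h')⟩

lemma ex_all (L : List (Fin 2)) (i : Fin 2) : ∃! g : Fin 2 → ℤ, IsGVec (clusterOf L i) g := by
  have hi : i = 0 ∨ i = 1 := by omega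
  rcases SGood_all L with h | ⟨n, h⟩ | ⟨n, h⟩ | ⟨n, h⟩ | ⟨n, h⟩ <;>
    have h := clusterOf_eq h <;> rcases hi with rfl | rfl
  · rw [h.1]; exact good_ex (posA 0).1 (HG_rA 0)
  · rw [h.2]; exact good_ex (CPos.init _) HG_x2
  · rw [h.1]; exact good_ex (posA n).1 (HG_rA n)
  · rw [h.2]; exact good_ex (posA n).2 (HG_vA n).1
  · rw [h.1]; exact good_ex (posA (n + 1)).1 (HG_rA (n + 1))
  · rw [h.2]; exact good_ex (posA n).2 (HG_vA n).1
  · rw [h.1]; exact good_ex (posB n).2 (HG_rB n)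
  · rw [h.2]; exact good_ex (posB n).1 (HG_vB n).1
  · rw [h.1]; exact good_ex (posB n).2 (HG_rB n)
  · rw [h.2]; exact good_ex (posB (n + 1)).1 (HG_vB n).2

/-! ### Density -/

def GU : Set (Fin 2 → ℝ) := {p : Fin 2 → ℝ | ∃ (L : List (Fin 2)) (g : Fin 2 → Fin 2 → ℤ),
        (∀ i, IsGVec (clusterOf L i) (g i)) ∧
        ∃ a : Fin 2 → ℝ, (∀ i, 0 ≤ a i) ∧
          p = ∑ i : Fin 2, a i • (fun j => ((g i j : ℝ)))}

lemma GU_mem {e a b c d : ℤ} {u v : CField 2} (h : ∃ L, SeedOf L = mkS e a b c d u v)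
    {g1 g2 h1 h2 : ℤ} (hu : u ∈ HG g1 g2) (hv : v ∈ HG h1 h2) {p : Fin 2 → ℝ} (s t : ℝ)
    (hs : 0 ≤ s) (ht : 0 ≤ t) (e0 : p 0 = s * g1 + t * h1) (e1 : p 1 = s * g2 + t * h2) :
    p ∈ GU := by
  obtain ⟨L, hL⟩ := h
  obtain ⟨c1, c2⟩ := clusterOf_eq hL
  refine ⟨L, ![![g1, g2], ![h1, h2]], ?_, ![s, t], ?_, ?_⟩
  · intro i
    fin_cases i
    · simpa [c1] using HG_isGVec hu
    · simpa [c2] using HG_isGVec hv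
  · intro i; fin_cases i <;> simpa
  · funext j
    fin_cases j
    · simpa [Fin.sum_univ_two] using e0
    · simpa [Fin.sum_univ_two] using e1

lemma fl {a s : ℝ} (ha : 0 ≤ a) (hs : 0 < s) : ∃ n : ℕ, 0 ≤ a - n * s ∧ 0 ≤ (n + 1) * s - a := by
  refine ⟨⌊a / s⌋₊, ?_, ?_⟩
  · have := Nat.floor_le (div_nonneg ha hs.le)
    rw [le_div_iff₀ hs] at this; linarith
  · have := (Nat.lt_floor_add_one (a / s)).le
    rw [div_le_iff₀ hs] at this; linarith

lemma GU_off {p : Fin 2 → ℝ} (hp : p 1 + 2 * p 0 ≠ 0) : p ∈ GU := by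
  rcases le_total 0 (p 0) with ha | ha
  · rcases lt_or_gt_of_ne hp with hs | hs
    · obtain ⟨n, h1, h2⟩ := fl ha (neg_pos.mpr hs)
      set s := -(p 1 + 2 * p 0) with hsd
      rcases le_total (p 0 - n * s) ((n + 1) * s - p 0) with h | h
      · refine GU_mem (reach_Ao n) (HG_rA _) (HG_vA n).1 (p 0 - n * s)
          (((n + 1) * s - p 0) - (p 0 - n * s)) h1 (by linarith) ?_ ?_ <;> push_cast
        · ring
        · rw [show p 1 = -s - 2 * p 0 by rw [hsd]; ring]; ring
      · refine GU_mem (reach_Ae (n + 1)) (HG_rA _) (HG_vA (n + 1)).1 ((n + 1) * s - p 0)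
          ((p 0 - n * s) - ((n + 1) * s - p 0)) h2 (by linarith) ?_ ?_ <;> push_cast
        · ring
        · rw [show p 1 = -s - 2 * p 0 by rw [hsd]; ring]; ring
    · obtain ⟨n, h1, h2⟩ := fl ha hs
      set s := (p 1 + 2 * p 0) with hsd
      rcases le_total (p 0 - n * s) ((n + 1) * s - p 0) with h | h
      · refine GU_mem (reach_Be n) (HG_rB _) (HG_vB n).1 (p 0 - n * s)
          (((n + 1) * s - p 0) - (p 0 - n * s)) h1 (by linarith) ?_ ?_ <;> push_cast
        · ring
        · rw [show p 1 = s - 2 * p 0 by rw [hsd]; ring]; ring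
      · refine GU_mem (reach_Bo n) (HG_rB _) (HG_vB n).2 ((n + 1) * s - p 0)
          ((p 0 - n * s) - ((n + 1) * s - p 0)) h2 (by linarith) ?_ ?_ <;> push_cast
        · ring
        · rw [show p 1 = s - 2 * p 0 by rw [hsd]; ring]; ring
  · rcases le_total 0 (p 1) with hb | hb
    · refine GU_mem reach_C (HG_rA 0) HG_x2 (-p 0) (p 1) (by linarith) hb ?_ ?_ <;> simp
    · refine GU_mem (reach_Ae 0) (HG_rA 0) (HG_vA 0).1 (-p 0) (-p 1) (by linarith) (by linarith)
        ?_ ?_ <;> simp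

lemma GU_dense : closure GU = Set.univ := by
  rw [Set.eq_univ_iff_forall]
  intro p
  by_cases hp : p 1 + 2 * p 0 = 0
  · have ht : Filter.Tendsto (fun n : ℕ => p + fun _ => (1 / ((n : ℝ) + 1))) Filter.atTop
        (nhds (p + fun _ => 0)) := by
      refine Filter.Tendsto.const_add _ ?_
      rw [tendsto_pi_nhds]
      intro _
      exact tendsto_one_div_add_atTop_nhds_zero_nat
    have hz : (p + fun _ => (0 : ℝ)) = p := by funext i; simp
    rw [hz] at ht
    refine mem_closure_of_tendsto ht (Filter.Eventually.of_forall fun n => GU_off ?_)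
    have : (0 : ℝ) < 1 / ((n : ℝ) + 1) := by positivity
    simp only [Pi.add_apply]
    intro h
    linarith
  · exact subset_closure (GU_off hp)

/-- every cluster variable of `A(B)` for `B = [[0,-1],[4,0]]` has a unique
g-vector, and the closure in `ℝ²` of the union of the g-vector cones
`C({g(z_1), g(z_2)})` over all clusters `(z_1, z_2)` of `A(B)` equals `ℝ²`. -/
theorem g_vector_cones_dense :
    (∀ (L : List (Fin 2)) (i : Fin 2), ∃! g : Fin 2 → ℤ, IsGVec (clusterOf L i) g) ∧
    closure {p : Fin 2 → ℝ | ∃ (L : List (Fin 2)) (g : Fin 2 → Fin 2 → ℤ),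
        (∀ i, IsGVec (clusterOf L i) (g i)) ∧
        ∃ a : Fin 2 → ℝ, (∀ i, 0 ≤ a i) ∧
          p = ∑ i : Fin 2, a i • (fun j => ((g i j : ℝ)))} = Set.univ := by
    exact ⟨ex_all, GU_dense⟩
end
end
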